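/- arXiv:2306.10904 — 12 statements merged into one kernel-verified Lean document; each statement's English description precedes it below -/
import Mathlib

section
/- Let ε ∈ (0,1] with 1/ε a positive integer, let k be a positive integer, and let U ≥ 0. For every nonempty finite job set S, SUP2-load(S) ≤ (1+ε)·load(S). Consequently, every partition of the job set into m subsets whose makespan with respect to load is at most OPT has makespan at most (1+ε)·OPT with respect to SUP2-load. -/
open Finset

/-- SUP load of a set of jobs: total size plus `U·⌊(|S|−1)/k⌋` idle time. -/
noncomputable def supLoad {ι : Type*} (k : ℕ) (U : ℝ) (p : ι → ℝ) (S : Finset ι) : ℝ :=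
  (∑ j ∈ S, p j) + (((S.card - 1) / k : ℕ) : ℝ) * U

/-- SUP2 load: if `|S| ≤ k·E` (with `E = 1/ε`) it is the SUP load; otherwise the
early jobs (the largest `k·E` jobs) keep their sizes, each of the `|S| − k·E` late
jobs gets modified size `p_j + U/k`, and exactly `E = 1/ε` idle periods are counted.
Since the early jobs and late jobs together sum to the whole set, this equals the
closed form below. -/
noncomputable def sup2Load {ι : Type*} (k E : ℕ) (U : ℝ) (p : ι → ℝ) (S : Finset ι) : ℝ :=
  if S.card ≤ k * E then supLoad k U p S
  else (∑ j ∈ S, p j) + ((S.card - k * E : ℕ) : ℝ) * (U / k) + (E : ℝ) * U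

theorem stmt2 {ι : Type*} [DecidableEq ι]
    (ε : ℝ) (E : ℕ) (hε : 0 < ε) (hε1 : ε ≤ 1) (hE : (E : ℝ) = 1 / ε)
    (k : ℕ) (hk : 0 < k) (U : ℝ) (hU : 0 ≤ U)
    (p : ι → ℝ) (hp : ∀ j, 0 ≤ p j) :
    (∀ S : Finset ι, S.Nonempty → sup2Load k E U p S ≤ (1 + ε) * supLoad k U p S) ∧
    (∀ (m : ℕ) (J : Finset ι) (P : Fin m → Finset ι) (OPT : ℝ),
      (∀ a b : Fin m, a ≠ b → Disjoint (P a) (P b)) →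
      Finset.univ.biUnion P = J →
      (∀ a, (P a).Nonempty → supLoad k U p (P a) ≤ OPT) →
      (∀ a, (P a).Nonempty → sup2Load k E U p (P a) ≤ (1 + ε) * OPT)) := by
  have key : ∀ S : Finset ι, S.Nonempty →
      sup2Load k E U p S ≤ (1 + ε) * supLoad k U p S := by
    intro S hS
    have hsum : 0 ≤ ∑ j ∈ S, p j := Finset.sum_nonneg (fun j _ => hp j)
    unfold sup2Load
    split_ifs with h
    · have h0 : 0 ≤ supLoad k U p S := by
        unfold supLoad
        positivity
      nlinarith [mul_nonneg hε.le h0]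
    · unfold supLoad
      have hlt : k * E < S.card := not_le.mp h
      obtain ⟨q, hq⟩ : ∃ q, q = (S.card - 1) / k := ⟨_, rfl⟩
      rw [← hq]
      have hEq : E ≤ q := by
        rw [hq, Nat.le_div_iff_mul_le hk, mul_comm]
        omega
      have hn : S.card ≤ k * (q + 1) := by
        have h1 := Nat.lt_mul_div_succ (S.card - 1) hk
        rw [← hq] at h1
        omega
      have hkR : (0 : ℝ) < k := by exact_mod_cast hk
      have hnR : (S.card : ℝ) ≤ k * (q + 1) := by exact_mod_cast hn
      have hEqR : (E : ℝ) ≤ q := by exact_mod_cast hEq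
      have h1 : 1 ≤ ε * q := by
        have h2 : ε * E = 1 := by rw [hE]; field_simp
        nlinarith
      have e1 : ((S.card - k * E : ℕ) : ℝ) * (U / k) + (E : ℝ) * U
          = (S.card : ℝ) / k * U := by
        rw [Nat.cast_sub hlt.le]
        push_cast
        field_simp
        ring
      have h3 : (S.card : ℝ) / k ≤ (1 + ε) * q := by
        rw [div_le_iff₀ hkR]
        nlinarith
      have h4 := mul_le_mul_of_nonneg_right h3 hU
      nlinarith [mul_nonneg hε.le hsum]
  refine ⟨key, ?_⟩
  intro m J P OPT _ _ hO a ha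
  exact (key _ ha).trans (mul_le_mul_of_nonneg_left (hO a ha) (by linarith))
end

section
/- Let ε ∈ (0,1] with 1/ε a positive integer, let k be a positive integer, and let U ≥ 0. For every nonempty finite job set S, load(S) ≤ SUP2-load(S). Consequently, every partition of the job set into m subsets whose SUP2-makespan is at most α has makespan at most α with respect to load. -/
open Finset

theorem stmt3 {ι : Type*} [DecidableEq ι]
    (ε : ℝ) (E : ℕ) (hε : 0 < ε) (hε1 : ε ≤ 1) (hE : (E : ℝ) = 1 / ε)
    (k : ℕ) (hk : 0 < k) (U : ℝ) (hU : 0 ≤ U)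
    (p : ι → ℝ) (hp : ∀ j, 0 ≤ p j) :
    (∀ S : Finset ι, S.Nonempty → supLoad k U p S ≤ sup2Load k E U p S) ∧
    (∀ (m : ℕ) (J : Finset ι) (P : Fin m → Finset ι) (α : ℝ),
      (∀ a b : Fin m, a ≠ b → Disjoint (P a) (P b)) →
      Finset.univ.biUnion P = J →
      (∀ a, (P a).Nonempty → sup2Load k E U p (P a) ≤ α) →
      (∀ a, (P a).Nonempty → supLoad k U p (P a) ≤ α)) := by
  have key : ∀ S : Finset ι, S.Nonempty → supLoad k U p S ≤ sup2Load k E U p S := by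
    intro S _
    unfold sup2Load
    split_ifs with h
    · exact le_rfl
    · unfold supLoad
      have hk' : (0 : ℝ) < k := by exact_mod_cast hk
      have h1 : (((S.card - 1) / k : ℕ) : ℝ) ≤ (S.card : ℝ) / k := by
        refine Nat.cast_div_le.trans ?_
        gcongr
        omega
      have h2 : ((S.card - k * E : ℕ) : ℝ) = (S.card : ℝ) - k * E := by
        rw [Nat.cast_sub (by omega)]
        push_cast
        ring
      have h3 : ((S.card : ℝ) - k * E) * (U / k) + E * U = (S.card : ℝ) / k * U := by
        field_simp
        ring
      have h4 := mul_le_mul_of_nonneg_right h1 hU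
      rw [h2]
      linarith
  exact ⟨key, fun m J P α _ _ h a ha => (key _ ha).trans (h a ha)⟩
end

section
/- Let ε ∈ (0,1] with 1/ε a positive integer, let T > 0, let U ≥ 0, let k be a positive integer, and let Lsiz be a finite set of sizes such that ℓ ≥ εT for every ℓ ∈ Lsiz and |Lsiz| ≤ log_{1+ε}(1/ε) + 1. Then the number of feasible configurations is at most 2·(1/ε + 1)^{log_{1+ε}(1/ε) + 4}. -/
open Finset

/-- A configuration for the scheduling problem SUP2: counts of large jobs of each
distinct large size, the rounded total size `β` of early small jobs, the rounded total
modified size `γ` of late small jobs, a bit `γ'` indicating the presence of late jobs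
(`γ = 0` whenever `γ' = 0`), and the rounded-up number of `k`-blocks of early jobs
`δ` with `1 ≤ δ ≤ 1/ε = E`. -/
structure SConfig (Lsiz : Finset ℝ) (E : ℕ) where
  alpha : {ℓ // ℓ ∈ Lsiz} → ℕ
  beta : ℕ
  gamma : ℕ
  gammaP : ℕ
  delta : ℕ
  gammaP_le_one : gammaP ≤ 1
  gamma_of_gammaP : gammaP = 0 → gamma = 0
  one_le_delta : 1 ≤ delta
  delta_le : delta ≤ E

/-- The load of a configuration. -/
noncomputable def sConfigLoad (ε T U : ℝ) {Lsiz : Finset ℝ} {E : ℕ}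
    (c : SConfig Lsiz E) : ℝ :=
  (∑ ℓ ∈ Lsiz.attach, (ℓ : ℝ) * (c.alpha ℓ : ℝ)) + (c.beta : ℝ) * (ε * T) +
    (c.gammaP : ℝ) * (c.gamma : ℝ) * (ε * T) + U * ((c.delta : ℝ) - 1 + (c.gammaP : ℝ))

theorem sconfig_bounds (ε T U : ℝ) (E : ℕ)
    (hε : 0 < ε) (hE : (E : ℝ) = 1 / ε) (hT : 0 < T) (hU : 0 ≤ U)
    (Lsiz : Finset ℝ) (hLsiz : ∀ ℓ ∈ Lsiz, ε * T ≤ ℓ)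
    (c : SConfig Lsiz E) (hc : sConfigLoad ε T U c ≤ T) :
    (∀ l, c.alpha l ≤ E) ∧ c.beta ≤ E ∧ c.gamma ≤ E := by
  have hεT : 0 < ε * T := mul_pos hε hT
  have key : ∀ n : ℕ, (n : ℝ) * (ε * T) ≤ T → n ≤ E := by
    intro n hn
    have h1 : (n : ℝ) ≤ E := by
      rw [hE, le_div_iff₀ hε]
      by_contra! h
      nlinarith
    exact_mod_cast h1
  have hnn : ∀ l ∈ Lsiz.attach, 0 ≤ (l : ℝ) * (c.alpha l : ℝ) := by
    intro l _
    exact mul_nonneg (hεT.le.trans (hLsiz l l.2)) (Nat.cast_nonneg _)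
  have hs : 0 ≤ ∑ ℓ ∈ Lsiz.attach, (ℓ : ℝ) * (c.alpha ℓ : ℝ) := Finset.sum_nonneg hnn
  have hb : 0 ≤ (c.beta : ℝ) * (ε * T) := by positivity
  have hg : 0 ≤ (c.gammaP : ℝ) * (c.gamma : ℝ) * (ε * T) := by positivity
  have hd1 : (1 : ℝ) ≤ c.delta := by exact_mod_cast c.one_le_delta
  have hd : 0 ≤ U * ((c.delta : ℝ) - 1 + (c.gammaP : ℝ)) := by
    apply mul_nonneg hU
    have : (0 : ℝ) ≤ c.gammaP := Nat.cast_nonneg _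
    linarith
  unfold sConfigLoad at hc
  refine ⟨?_, ?_, ?_⟩
  · intro l
    apply key
    have h1 := Finset.single_le_sum hnn (Finset.mem_attach _ l)
    have h2 : (c.alpha l : ℝ) * (ε * T) ≤ (l : ℝ) * (c.alpha l : ℝ) := by
      rw [mul_comm]
      exact mul_le_mul_of_nonneg_right (hLsiz l l.2) (Nat.cast_nonneg _)
    linarith
  · apply key
    linarith
  · have h01 := c.gammaP_le_one
    rcases Nat.eq_zero_or_pos c.gammaP with h | h
    · rw [c.gamma_of_gammaP h]
      exact Nat.zero_le _
    · have h1 : c.gammaP = 1 := by omega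
      apply key
      rw [h1] at hc hg hd
      simp only [Nat.cast_one, one_mul] at hc hg hd
      linarith

/-- The parameter tuple of a configuration. -/
def sconfigCode {Lsiz : Finset ℝ} {E : ℕ} (c : SConfig Lsiz E) :
    ({ℓ // ℓ ∈ Lsiz} → Fin (E + 1)) × Fin (E + 1) × Fin (E + 1) × Fin 2 × Fin (E + 1) :=
  (fun l => Fin.ofNat (E + 1) (c.alpha l), Fin.ofNat (E + 1) c.beta, Fin.ofNat (E + 1) c.gamma,
    Fin.ofNat 2 c.gammaP, Fin.ofNat (E + 1) c.delta)

theorem ofNat_inj_aux (n a b : ℕ) (ha : a ≤ n) (hb : b ≤ n)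
    (h : Fin.ofNat (n + 1) a = Fin.ofNat (n + 1) b) : a = b := by
  have h1 := congrArg Fin.val h
  simp only [Fin.val_ofNat] at h1
  rwa [Nat.mod_eq_of_lt (by omega), Nat.mod_eq_of_lt (by omega)] at h1

theorem stmt4 (ε T U : ℝ) (E k : ℕ)
    (hε : 0 < ε) (hε1 : ε ≤ 1) (hE : (E : ℝ) = 1 / ε) (hT : 0 < T)
    (hk : 0 < k) (hU : 0 ≤ U)
    (Lsiz : Finset ℝ) (hLsiz : ∀ ℓ ∈ Lsiz, ε * T ≤ ℓ)
    (hLsizcard : (Lsiz.card : ℝ) ≤ Real.logb (1 + ε) (1 / ε) + 1)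
    (F : Finset (SConfig Lsiz E)) (hF : ∀ c ∈ F, sConfigLoad ε T U c ≤ T) :
    (F.card : ℝ) ≤ 2 * (1 / ε + 1) ^ (Real.logb (1 + ε) (1 / ε) + 4) := by
  classical
  have hcard : F.card ≤ 2 * (E + 1) ^ (Lsiz.card + 3) := by
    have h := Finset.card_le_card_of_injOn (s := F) (t := Finset.univ) sconfigCode
      (fun _ _ => Finset.mem_coe.2 (Finset.mem_univ _)) (by
        intro c hc d hd h
        obtain ⟨ca, cb, cg⟩ := sconfig_bounds ε T U E hε hE hT hU Lsiz hLsiz c (hF c hc)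
        obtain ⟨da, db, dg⟩ := sconfig_bounds ε T U E hε hE hT hU Lsiz hLsiz d (hF d hd)
        simp only [sconfigCode, Prod.mk.injEq] at h
        obtain ⟨h1, h2, h3, h4, h5⟩ := h
        have e1 : c.alpha = d.alpha :=
          funext fun l => ofNat_inj_aux _ _ _ (ca l) (da l) (congrFun h1 l)
        have e2 := ofNat_inj_aux _ _ _ cb db h2
        have e3 := ofNat_inj_aux _ _ _ cg dg h3
        have e4 := ofNat_inj_aux 1 _ _ c.gammaP_le_one d.gammaP_le_one h4
        have e5 := ofNat_inj_aux _ _ _ c.delta_le d.delta_le h5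
        cases c
        cases d
        simp_all)
    refine h.trans (le_of_eq ?_)
    simp only [Finset.card_univ, Fintype.card_prod, Fintype.card_fun, Fintype.card_fin,
      Fintype.card_coe]
    ring
  have h1 : (F.card : ℝ) ≤ 2 * ((E : ℝ) + 1) ^ (Lsiz.card + 3) := by exact_mod_cast hcard
  rw [hE] at h1
  refine h1.trans ?_
  have hpos : 0 < 1 / ε := by positivity
  rw [← Real.rpow_natCast]
  gcongr
  · linarith
  · push_cast
    linarith
end

section
/- Fix ε ∈ (0,1] with 1/ε a positive integer, T > 0, a positive integer k, U ≥ 0, and m machines. Let J be a finite set of jobs, let S = {j ∈ J : p_j < εT} be the small jobs, let Lsiz be the set of distinct sizes of the large jobs (those with p_j ≥ εT), and let n_ℓ be the number of large jobs of size ℓ. If there exists a partition of J into m subsets each of SUP2-load at most T, then there exist x : C → ℕ (where C is the set of feasible configurations) and y, z : S × C → [0,1] ∩ ℚ such that: Σ_{c∈C} x_c = m; Σ_{c∈C} (y_{jc} + z_{jc}) = 1 for every j ∈ S; Σ_{j∈S} y_{jc}·p_j ≤ x_c·(β_c + 1)·εT for every c ∈ C; Σ_{j∈S} z_{jc}·p̃_j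 ≤ x_c·γ'_c·(γ_c + 1)·εT for every c ∈ C; Σ_{c∈C} α_{cℓ}·x_c = n_ℓ for every ℓ ∈ Lsiz; and x_c·Σ_{ℓ∈Lsiz} α_{cℓ} + Σ_{j∈S} y_{jc} ≤ x_c·δ_c·k for every c ∈ C. -/
open Finset

lemma machine_aux {ι : Type*} [DecidableEq ι] (ε T U : ℝ) (E k : ℕ)
    (hε : 0 < ε) (hε1 : ε ≤ 1) (hE : (E : ℝ) = 1 / ε) (hT : 0 < T)
    (hk : 0 < k) (hU : 0 ≤ U) (p : ι → ℝ) (S : Finset ι) (hp : ∀ j ∈ S, 0 ≤ p j)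
    (Lsiz : Finset ℝ) (hL1 : ∀ l ∈ Lsiz, ε * T ≤ l)
    (hL2 : ∀ j ∈ S, ε * T ≤ p j → p j ∈ Lsiz)
    (hS : sup2Load k E U p S ≤ T) :
    ∃ (c : SConfig Lsiz E) (A B : Finset ι), Disjoint A B ∧
      A ∪ B = S.filter (fun j => p j < ε * T) ∧
      sConfigLoad ε T U c ≤ T ∧
      (∑ j ∈ A, p j) ≤ ((c.beta : ℝ) + 1) * (ε * T) ∧
      (∑ j ∈ B, (p j + U / k)) ≤ (c.gammaP : ℝ) * ((c.gamma : ℝ) + 1) * (ε * T) ∧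
      (∀ l : {l // l ∈ Lsiz}, c.alpha l = (S.filter fun j => p j = (l : ℝ)).card) ∧
      (∑ l ∈ Lsiz.attach, (c.alpha l : ℝ)) + (A.card : ℝ) ≤ (c.delta : ℝ) * k := by
  have hεT : 0 < ε * T := mul_pos hε hT
  have hkR : (0 : ℝ) < k := by exact_mod_cast hk
  have hE1 : 1 ≤ E := by
    have : (1 : ℝ) ≤ E := by rw [hE]; exact one_le_one_div hε hε1
    exact_mod_cast this
  have hEe : (E : ℝ) * ε = 1 := by rw [hE]; field_simp
  set Sm := S.filter (fun j => p j < ε * T) with hSm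
  set La := S.filter (fun j => ¬ p j < ε * T) with hLa
  have hsplit : ∑ j ∈ Sm, p j + ∑ j ∈ La, p j = ∑ j ∈ S, p j :=
    Finset.sum_filter_add_sum_filter_not S _ _
  have hcard : Sm.card + La.card = S.card := Finset.card_filter_add_card_filter_not _
  have hmaps : ∀ j ∈ La, p j ∈ Lsiz := by
    intro j hj
    simp only [hLa, Finset.mem_filter, not_lt] at hj
    exact hL2 j hj.1 hj.2
  have hfib : ∀ l ∈ Lsiz, S.filter (fun j => p j = l) = La.filter (fun j => p j = l) := by
    intro l hl
    ext j
    simp only [hLa, Finset.mem_filter, not_lt]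
    constructor
    · rintro ⟨h1, h2⟩; exact ⟨⟨h1, h2 ▸ hL1 l hl⟩, h2⟩
    · rintro ⟨⟨h1, _⟩, h2⟩; exact ⟨h1, h2⟩
  have hA1 : ∑ l ∈ Lsiz.attach, ((l : ℝ) * ((S.filter fun j => p j = (l : ℝ)).card : ℝ))
      = ∑ j ∈ La, p j := by
    rw [Finset.sum_attach Lsiz (fun l => l * ((S.filter fun j => p j = l).card : ℝ)),
      ← Finset.sum_fiberwise_of_maps_to hmaps]
    refine Finset.sum_congr rfl fun l hl => ?_
    rw [hfib l hl, Finset.sum_congr rfl (g := fun _ => l)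
      (fun j hj => (Finset.mem_filter.1 hj).2)]
    simp [mul_comm]
  have hA2 : ∑ l ∈ Lsiz.attach, ((S.filter fun j => p j = (l : ℝ)).card : ℝ)
      = (La.card : ℝ) := by
    rw [Finset.sum_attach Lsiz (fun l => ((S.filter fun j => p j = l).card : ℝ)),
      Finset.card_eq_sum_card_fiberwise hmaps]
    push_cast
    refine Finset.sum_congr rfl fun l hl => ?_
    rw [hfib l hl]
  have hfl1 : ∀ s : ℝ, 0 ≤ s → (⌊s / (ε * T)⌋₊ : ℝ) * (ε * T) ≤ s := by
    intro s hs
    have := Nat.floor_le (div_nonneg hs hεT.le)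
    rwa [le_div_iff₀ hεT] at this
  have hfl2 : ∀ s : ℝ, s ≤ ((⌊s / (ε * T)⌋₊ : ℝ) + 1) * (ε * T) := by
    intro s
    have := (Nat.lt_floor_add_one (s / (ε * T))).le
    rwa [div_le_iff₀ hεT] at this
  have hSm0 : ∀ j ∈ Sm, 0 ≤ p j := fun j hj => hp j (Finset.mem_filter.1 hj).1
  by_cases hc : S.card ≤ k * E
  · rw [sup2Load, if_pos hc, supLoad] at hS
    have hd : (S.card - 1) / k + 1 ≤ E := by
      have : (S.card - 1) / k < E := by
        rw [Nat.div_lt_iff_lt_mul hk]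
        have : 0 < k * E := Nat.mul_pos hk hE1
        rw [mul_comm E k]; omega
      exact this
    refine ⟨⟨fun l => (S.filter fun j => p j = (l : ℝ)).card,
      ⌊(∑ j ∈ Sm, p j) / (ε * T)⌋₊, 0, 0, (S.card - 1) / k + 1, by simp, by simp,
      by simp, hd⟩, Sm, ∅, by simp, by simp, ?_, hfl2 _, by simp, fun l => rfl, ?_⟩
    · simp only [sConfigLoad]
      rw [hA1]
      have := hfl1 _ (Finset.sum_nonneg hSm0)
      push_cast at hS ⊢
      nlinarith
    · simp only
      rw [hA2]
      have h1 : S.card - 1 < k * ((S.card - 1) / k + 1) := Nat.lt_mul_div_succ _ hk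
      have h2 : La.card + Sm.card ≤ ((S.card - 1) / k + 1) * k := by
        rw [mul_comm _ k]; omega
      exact_mod_cast h2
  · rw [sup2Load, if_neg hc] at hS
    push Not at hc
    have hx : 0 ≤ ((S.card - k * E : ℕ) : ℝ) * (U / k) := by positivity
    have hy : 0 ≤ (E : ℝ) * U := by positivity
    have hLE : La.card ≤ k * E := by
      have h1 : (La.card : ℝ) * (ε * T) ≤ ∑ j ∈ La, p j := by
        rw [← nsmul_eq_mul]
        exact Finset.card_nsmul_le_sum _ _ _ fun j hj => not_lt.1 (Finset.mem_filter.1 hj).2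
      have h0 := Finset.sum_nonneg hSm0
      have h2 : (La.card : ℝ) * (ε * T) ≤ E * (ε * T) := by
        have : (E : ℝ) * (ε * T) = T := by rw [← mul_assoc, hEe, one_mul]
        linarith
      have h3 : (La.card : ℝ) ≤ E := le_of_mul_le_mul_right h2 hεT
      have h4 : La.card ≤ E := by exact_mod_cast h3
      nlinarith
    obtain ⟨A, hAS, hAc⟩ := Finset.exists_subset_card_eq (s := Sm) (n := k * E - La.card) (by omega)
    have hBc : (Sm \ A).card = S.card - k * E := by
      rw [Finset.card_sdiff_of_subset hAS]; omega
    have hsum : ∑ j ∈ Sm \ A, p j + ∑ j ∈ A, p j = ∑ j ∈ Sm, p j := Finset.sum_sdiff hAS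
    have hBs : ∑ j ∈ Sm \ A, (p j + U / k) =
        ∑ j ∈ Sm \ A, p j + ((S.card - k * E : ℕ) : ℝ) * (U / k) := by
      rw [Finset.sum_add_distrib, Finset.sum_const, hBc, nsmul_eq_mul]
    refine ⟨⟨fun l => (S.filter fun j => p j = (l : ℝ)).card,
      ⌊(∑ j ∈ A, p j) / (ε * T)⌋₊, ⌊(∑ j ∈ Sm \ A, (p j + U / k)) / (ε * T)⌋₊, 1, E,
      by simp, by simp, hE1, le_rfl⟩, A, Sm \ A, Finset.disjoint_sdiff,
      Finset.union_sdiff_of_subset hAS, ?_, hfl2 _, ?_, fun l => rfl, ?_⟩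
    · simp only [sConfigLoad]
      rw [hA1]
      have h1 := hfl1 (∑ j ∈ A, p j) (Finset.sum_nonneg fun j hj => hSm0 j (hAS hj))
      have h2 := hfl1 (∑ j ∈ Sm \ A, (p j + U / k)) (Finset.sum_nonneg fun j hj =>
        add_nonneg (hSm0 j (Finset.mem_sdiff.1 hj).1) (by positivity))
      push_cast
      nlinarith
    · simpa using hfl2 (∑ j ∈ Sm \ A, (p j + U / k))
    · simp only
      rw [hA2, hAc]
      have : La.card + (k * E - La.card) ≤ E * k := by rw [mul_comm E k]; omega
      exact_mod_cast this

theorem stmt5 {ι : Type*} [DecidableEq ι]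
    (ε T U : ℝ) (E k m : ℕ)
    (hε : 0 < ε) (hε1 : ε ≤ 1) (hE : (E : ℝ) = 1 / ε) (hT : 0 < T)
    (hk : 0 < k) (hU : 0 ≤ U) (hm : 0 < m)
    (J : Finset ι) (p : ι → ℝ) (hp : ∀ j ∈ J, 0 ≤ p j)
    (Sma Lar : Finset ι)
    (hSma : Sma = J.filter fun j => p j < ε * T)
    (hLar : Lar = J.filter fun j => ε * T ≤ p j)
    (Lsiz : Finset ℝ) (hLsiz : Lsiz = Lar.image p)
    (hsched : ∃ P : Fin m → Finset ι,
      (∀ a b : Fin m, a ≠ b → Disjoint (P a) (P b)) ∧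
      Finset.univ.biUnion P = J ∧
      ∀ a, sup2Load k E U p (P a) ≤ T) :
    ∃ (F : Finset (SConfig Lsiz E)) (x : SConfig Lsiz E → ℕ)
      (y z : ι → SConfig Lsiz E → ℝ),
      (∀ c ∈ F, sConfigLoad ε T U c ≤ T) ∧
      (∑ c ∈ F, x c) = m ∧
      (∀ j ∈ Sma, (∑ c ∈ F, (y j c + z j c)) = 1) ∧
      (∀ j ∈ Sma, ∀ c ∈ F, 0 ≤ y j c ∧ y j c ≤ 1 ∧ 0 ≤ z j c ∧ z j c ≤ 1) ∧
      (∀ c ∈ F, (∑ j ∈ Sma, y j c * p j) ≤ (x c : ℝ) * ((c.beta : ℝ) + 1) * (ε * T)) ∧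
      (∀ c ∈ F, (∑ j ∈ Sma, z j c * (p j + U / k)) ≤
        (x c : ℝ) * (c.gammaP : ℝ) * ((c.gamma : ℝ) + 1) * (ε * T)) ∧
      (∀ ℓ : {ℓ // ℓ ∈ Lsiz},
        (∑ c ∈ F, c.alpha ℓ * x c) = (Lar.filter fun j => p j = (ℓ : ℝ)).card) ∧
      (∀ c ∈ F, (x c : ℝ) * (∑ ℓ ∈ Lsiz.attach, (c.alpha ℓ : ℝ)) + (∑ j ∈ Sma, y j c) ≤
        (x c : ℝ) * (c.delta : ℝ) * k) := by
  classical
  obtain ⟨P, hdis, hun, hload⟩ := hsched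
  have hPJ : ∀ a, P a ⊆ J := fun a => hun ▸ Finset.subset_biUnion_of_mem P (Finset.mem_univ a)
  have hL1 : ∀ l ∈ Lsiz, ε * T ≤ l := by
    intro l hl
    rw [hLsiz, hLar] at hl
    obtain ⟨j, hj, rfl⟩ := Finset.mem_image.1 hl
    exact (Finset.mem_filter.1 hj).2
  have hL2 : ∀ j ∈ J, ε * T ≤ p j → p j ∈ Lsiz := by
    intro j hj h
    rw [hLsiz, hLar]
    exact Finset.mem_image_of_mem _ (Finset.mem_filter.2 ⟨hj, h⟩)
  choose cf A B hAB hABu hcl hbeta hgam halp hdel using fun a =>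
    machine_aux ε T U E k hε hε1 hE hT hk hU p (P a) (fun j hj => hp j (hPJ a hj)) Lsiz hL1
      (fun j hj => hL2 j (hPJ a hj)) (hload a)
  have hASm : ∀ a, A a ⊆ Sma := by
    intro a j hj
    have : j ∈ A a ∪ B a := Finset.mem_union_left _ hj
    rw [hABu, Finset.mem_filter] at this
    rw [hSma, Finset.mem_filter]; exact ⟨hPJ a this.1, this.2⟩
  have hBSm : ∀ a, B a ⊆ Sma := by
    intro a j hj
    have : j ∈ A a ∪ B a := Finset.mem_union_right _ hj
    rw [hABu, Finset.mem_filter] at this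
    rw [hSma, Finset.mem_filter]; exact ⟨hPJ a this.1, this.2⟩
  have hmaps : ∀ a ∈ (Finset.univ : Finset (Fin m)), cf a ∈ Finset.univ.image cf :=
    fun a ha => Finset.mem_image_of_mem _ ha
  set fib : SConfig Lsiz E → Finset (Fin m) := fun c => Finset.univ.filter fun a => cf a = c
    with hfib
  have hfm : ∀ c, ∀ a ∈ fib c, cf a = c := fun c a ha => (Finset.mem_filter.1 ha).2
  have key : ∀ (D : Fin m → Finset ι) (w : ι → ℝ) (c : SConfig Lsiz E), (∀ a, D a ⊆ Sma) →
      ∑ j ∈ Sma, (∑ a ∈ fib c, if j ∈ D a then (1 : ℝ) else 0) * w j =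
        ∑ a ∈ fib c, ∑ j ∈ D a, w j := by
    intro D w c hD
    simp only [Finset.sum_mul]
    rw [Finset.sum_comm]
    refine Finset.sum_congr rfl fun a _ => ?_
    simp only [ite_mul, one_mul, zero_mul]
    rw [← Finset.sum_filter, Finset.filter_mem_eq_inter, Finset.inter_eq_right.2 (hD a)]
  have hone : ∀ j ∈ Sma, (∑ c ∈ Finset.univ.image cf,
      ((∑ a ∈ fib c, if j ∈ A a then (1 : ℝ) else 0) +
        (∑ a ∈ fib c, if j ∈ B a then (1 : ℝ) else 0))) = 1 := by
    intro j hj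
    simp only [← Finset.sum_add_distrib]
    rw [Finset.sum_fiberwise_of_maps_to hmaps]
    rw [hSma, Finset.mem_filter] at hj
    have hjm := hj.1
    rw [← hun, Finset.mem_biUnion] at hjm
    obtain ⟨a, -, ha⟩ := hjm
    rw [Finset.sum_eq_single a]
    · have h1 : j ∈ A a ∪ B a := by rw [hABu, Finset.mem_filter]; exact ⟨ha, hj.2⟩
      rcases Finset.mem_union.1 h1 with h | h
      · simp [h, Finset.disjoint_left.1 (hAB a) h]
      · simp [h, Finset.disjoint_right.1 (hAB a) h]
    · intro b _ hb
      have h1 : j ∉ A b ∪ B b := by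
        rw [hABu, Finset.mem_filter]
        exact fun h => Finset.disjoint_left.1 (hdis b a hb) h.1 ha
      rw [Finset.mem_union, not_or] at h1
      simp [h1.1, h1.2]
    · simp
  have hnn : ∀ (D : Fin m → Finset ι) (j : ι) (c : SConfig Lsiz E),
      0 ≤ ∑ a ∈ fib c, if j ∈ D a then (1 : ℝ) else 0 := fun D j c =>
    Finset.sum_nonneg fun a _ => by split_ifs <;> norm_num
  refine ⟨Finset.univ.image cf, fun c => (fib c).card,
    fun j c => ∑ a ∈ fib c, if j ∈ A a then (1 : ℝ) else 0,
    fun j c => ∑ a ∈ fib c, if j ∈ B a then (1 : ℝ) else 0, ?_, ?_, hone, ?_, ?_, ?_, ?_, ?_⟩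
  · intro c hc
    obtain ⟨a, -, rfl⟩ := Finset.mem_image.1 hc
    exact hcl a
  · rw [← Finset.card_eq_sum_card_fiberwise hmaps]; simp
  · intro j hj c hc
    have h1 := hone j hj
    have h2 := Finset.single_le_sum (f := fun c =>
      ((∑ a ∈ fib c, if j ∈ A a then (1 : ℝ) else 0) +
        (∑ a ∈ fib c, if j ∈ B a then (1 : ℝ) else 0)))
      (fun c _ => add_nonneg (hnn A j c) (hnn B j c)) hc
    rw [h1] at h2
    have h3 := hnn A j c
    have h4 := hnn B j c
    exact ⟨h3, by linarith, h4, by linarith⟩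
  · intro c hc
    rw [key A p c hASm, mul_assoc, ← nsmul_eq_mul]
    refine Finset.sum_le_card_nsmul _ _ _ fun a ha => ?_
    rw [← hfm c a ha]; exact hbeta a
  · intro c hc
    rw [key B (fun j => p j + U / k) c hBSm, mul_assoc, mul_assoc, ← nsmul_eq_mul, ← mul_assoc]
    refine Finset.sum_le_card_nsmul _ _ _ fun a ha => ?_
    rw [← hfm c a ha]; exact hgam a
  · intro l
    have h1 : ∀ c, c.alpha l * (fib c).card = ∑ a ∈ fib c, (cf a).alpha l := by
      intro c
      rw [Finset.sum_congr rfl (g := fun _ => c.alpha l) (fun a ha => by rw [hfm c a ha])]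
      simp [mul_comm]
    simp only [h1]
    rw [Finset.sum_fiberwise_of_maps_to hmaps]
    simp only [halp]
    rw [← Finset.card_biUnion]
    · congr 1
      ext j
      have hj : j ∈ J ↔ ∃ a, j ∈ P a := by rw [← hun]; simp
      have := hL1 l l.2
      simp only [Finset.mem_biUnion, Finset.mem_univ, true_and, Finset.mem_filter, hLar, hj]
      constructor
      · rintro ⟨a, h1, h2⟩; exact ⟨⟨⟨a, h1⟩, h2 ▸ this⟩, h2⟩
      · rintro ⟨⟨⟨a, h1⟩, -⟩, h2⟩; exact ⟨a, h1, h2⟩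
    · intro a _ b _ hab
      exact Finset.disjoint_filter_filter (hdis a b hab)
  · intro c hc
    have h1 := key A (fun _ => 1) c hASm
    simp only [mul_one] at h1
    have h2 : ∀ r : ℝ, ((fib c).card : ℝ) * r = ∑ _a ∈ fib c, r := by
      intro r; rw [Finset.sum_const, nsmul_eq_mul]
    rw [h1, mul_assoc, h2, h2, ← Finset.sum_add_distrib]
    refine Finset.sum_le_sum fun a ha => ?_
    have := hdel a
    rw [hfm c a ha] at this
    simpa using this
end

section
/- Let n and m be positive integers, let π_1, …, π_n ≥ 0, and for each i ∈ {1,…,m} let c_i ∈ ℕ and t_i ≥ 0. If there exists a fractional assignment u ∈ [0,1]^{m×n} satisfying Σ_{j=1}^n π_j·u_{ij} ≤ t_i and Σ_{j=1}^n u_{ij} ≤ c_i for every i, and Σ_{i=1}^m u_{ij} = 1 for every j, then there exists an integral assignment u' ∈ {0,1}^{m×n} satisfying Σ_{j=1}^n π_j·u'_{ij} ≤ t_i + π_max and Σ_{j=1}^n u'_{ij} ≤ c_i for every i, and Σ_{i=1}^m u'_{ij} = 1 for every j, where π_max = max_j π_j. -/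
open Finset

def clampK (k : ℕ) (x : ℝ) : ℝ := min (max x k) (k + 1) - k

lemma clampK_mono (k : ℕ) {x y : ℝ} (h : x ≤ y) : clampK k x ≤ clampK k y := by
  unfold clampK; gcongr

lemma clampK_sum (c : ℕ) (x : ℝ) (h : 0 ≤ x) : ∑ k ∈ range c, clampK k x = min x c := by
  induction c with
  | zero => simp [h]
  | succ c ih =>
    rw [sum_range_succ, ih]
    unfold clampK
    push_cast
    rcases le_total x c with h1 | h1
    · rw [min_eq_left h1, max_eq_right h1, min_eq_left (by linarith), min_eq_left (by linarith)]
      ring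
    · rw [min_eq_right h1, max_eq_left h1]; ring

lemma single_machine (n c : ℕ) (π : Fin n → ℝ) (hanti : Antitone π) (u : Fin n → ℝ)
    (hu : ∀ j, 0 ≤ u j) (hc : ∑ j, u j ≤ c) :
    ∃ w : ℕ → Fin n → ℝ, (∀ k j, 0 ≤ w k j) ∧ (∀ j, ∑ k ∈ range c, w k j = u j) ∧
      (∀ k, ∑ j, w k j ≤ 1) ∧
      (∀ k j, 0 < w (k+1) j → π j ≤ ∑ j', π j' * w k j') := by
  let v : ℕ → ℝ := fun j => if h : j < n then u ⟨j, h⟩ else 0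
  have hv : ∀ j, 0 ≤ v j := by
    intro j; simp only [v]; split_ifs
    · exact hu _
    · exact le_rfl
  have hvj : ∀ j : Fin n, v j = u j := by intro j; simp [v]
  let F : ℕ → ℝ := fun k => ∑ j ∈ range k, v j
  have hF1 : ∀ j, F (j+1) = F j + v j := fun j => sum_range_succ _ _
  have hFm : Monotone F := monotone_nat_of_le_succ (fun j => by rw [hF1]; linarith [hv j])
  have hF0 : F 0 = 0 := by simp [F]
  have hFnn : ∀ k, 0 ≤ F k := fun k => sum_nonneg (fun j _ => hv j)
  have hFn : F n ≤ c := by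
    have : F n = ∑ j, u j := by
      simp only [F]; rw [← Fin.sum_univ_eq_sum_range]; simp [hvj]
    rw [this]; exact hc
  have hFc : ∀ k ≤ n, F k ≤ c := fun k hk => (hFm hk).trans hFn
  have htel : ∀ k, ∑ j : Fin n, (clampK k (F (j+1)) - clampK k (F j)) = clampK k (F n) := by
    intro k
    rw [Fin.sum_univ_eq_sum_range (fun j => clampK k (F (j+1)) - clampK k (F j)),
      sum_range_sub (fun j => clampK k (F j)), hF0]
    simp [clampK]
  refine ⟨fun k j => clampK k (F (j+1)) - clampK k (F j), ?_, ?_, ?_, ?_⟩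
  · intro k j
    exact sub_nonneg.2 (clampK_mono k (hFm (Nat.le_succ _)))
  · intro j
    rw [sum_sub_distrib, clampK_sum _ _ (hFnn _), clampK_sum _ _ (hFnn _),
      min_eq_left (hFc _ j.2), min_eq_left (hFc _ j.2.le), hF1, hvj]
    ring
  · intro k
    rw [htel]
    unfold clampK
    linarith [min_le_right (max (F n) k) ((k:ℝ) + 1)]
  · intro k j hw
    have h1 : (k:ℝ) + 1 < F (j+1) := by
      by_contra hcon
      push Not at hcon
      have h2 : F j ≤ F (j+1) := hFm (Nat.le_succ _)
      have h3 : ((k+1 : ℕ) : ℝ) = k + 1 := by push_cast; ring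
      unfold clampK at hw
      beta_reduce at hw
      rw [h3, max_eq_right hcon, max_eq_right (h2.trans hcon)] at hw
      linarith
    have hfull : clampK k (F n) = 1 := by
      have : F (j+1) ≤ F n := hFm j.2
      unfold clampK
      rw [max_eq_left (by linarith), min_eq_right (by linarith)]; ring
    calc π j = π j * ∑ j' : Fin n, (clampK k (F (j'+1)) - clampK k (F j')) := by
            rw [htel, hfull, mul_one]
      _ = ∑ j' : Fin n, π j * (clampK k (F (j'+1)) - clampK k (F j')) := by rw [mul_sum]
      _ ≤ _ := by
        apply sum_le_sum
        intro j' _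
        have h2 : F j' ≤ F (j'+1) := hFm (Nat.le_succ _)
        by_cases hjj : j' ≤ j
        · exact mul_le_mul_of_nonneg_right (hanti hjj) (sub_nonneg.2 (clampK_mono k h2))
        · have h4 : F (j+1) ≤ F j' := hFm (by rw [not_le] at hjj; exact hjj)
          have : clampK k (F (j'+1)) - clampK k (F j') = 0 := by
            unfold clampK
            rw [max_eq_left (by linarith), min_eq_right (by linarith),
              max_eq_left (by linarith), min_eq_right (by linarith)]; ring
          beta_reduce
          rw [this]; simp

lemma sorted_case (n m : ℕ) (π : Fin n → ℝ) (hπ : ∀ j, 0 ≤ π j) (hanti : Antitone π)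
    (c : Fin m → ℕ) (t : Fin m → ℝ) (P : ℝ) (hP0 : 0 ≤ P) (hP : ∀ j, π j ≤ P)
    (u : Fin m → Fin n → ℝ)
    (hu0 : ∀ i j, 0 ≤ u i j)
    (hsize : ∀ i, (∑ j, π j * u i j) ≤ t i)
    (hcard : ∀ i, (∑ j, u i j) ≤ (c i : ℝ))
    (hassign : ∀ j, (∑ i, u i j) = 1) :
    ∃ u' : Fin m → Fin n → ℝ,
      (∀ i j, u' i j = 0 ∨ u' i j = 1) ∧
      (∀ i, (∑ j, π j * u' i j) ≤ t i + P) ∧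
      (∀ i, (∑ j, u' i j) ≤ (c i : ℝ)) ∧
      (∀ j, (∑ i, u' i j) = 1) := by
  classical
  choose w hw0 hwu hw1 hwπ using fun i => single_machine n (c i) π hanti (u i) (hu0 i) (hcard i)
  let N : Fin n → Finset (Σ i, Fin (c i)) := fun j => univ.filter (fun s => 0 < w s.1 s.2 j)
  have htot : ∀ j, ∑ s : (Σ i, Fin (c i)), w s.1 s.2 j = 1 := by
    intro j
    rw [Fintype.sum_sigma, ← hassign j]
    refine sum_congr rfl fun i _ => ?_
    rw [← hwu i j, ← Fin.sum_univ_eq_sum_range (fun k => w i k j)]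
  have hall : ∀ S : Finset (Fin n), #S ≤ #(S.biUnion N) := by
    intro S
    have : (#S : ℝ) ≤ #(S.biUnion N) := by
      calc (#S : ℝ) = ∑ j ∈ S, ∑ s : (Σ i, Fin (c i)), w s.1 s.2 j := by simp [htot]
        _ = ∑ j ∈ S, ∑ s ∈ S.biUnion N, w s.1 s.2 j := by
          refine sum_congr rfl fun j hj => ?_
          symm
          apply sum_subset (subset_univ _)
          intro s _ hs
          by_contra hne
          apply hs
          rw [mem_biUnion]
          exact ⟨j, hj, by simp only [N, mem_filter, mem_univ, true_and]; exact lt_of_le_of_ne (hw0 _ _ _) (Ne.symm hne)⟩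
        _ = ∑ s ∈ S.biUnion N, ∑ j ∈ S, w s.1 s.2 j := sum_comm
        _ ≤ ∑ s ∈ S.biUnion N, (1:ℝ) := by
          refine sum_le_sum fun s _ => ?_
          exact (sum_le_sum_of_subset_of_nonneg (subset_univ _) (fun j _ _ => hw0 _ _ _)).trans (hw1 s.1 s.2)
        _ = _ := by simp
    exact_mod_cast this
  obtain ⟨f, hfinj, hf⟩ := (Finset.all_card_le_biUnion_card_iff_exists_injective N).1 hall
  have hf' : ∀ j, 0 < w (f j).1 (f j).2 j := by
    intro j; have := hf j; simpa [N] using this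
  have hinj : ∀ i, Set.InjOn (fun j => ((f j).2 : ℕ)) (univ.filter (fun j => (f j).1 = i) : Finset (Fin n)) := by
    intro i a ha b hb hab
    simp only [coe_filter, mem_univ, true_and, Set.mem_ofPred_eq] at ha hb hab
    apply hfinj
    generalize f a = x at *
    generalize f b = y at *
    obtain ⟨x1, x2⟩ := x
    obtain ⟨y1, y2⟩ := y
    simp only at ha hb hab
    subst ha
    subst hb
    rw [Fin.ext hab]
  have hmem : ∀ i, ∀ j ∈ (univ.filter (fun j => (f j).1 = i) : Finset (Fin n)), ((f j).2 : ℕ) ∈ range (c i) := by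
    intro i j hj
    simp only [mem_filter, mem_univ, true_and] at hj
    subst hj
    simp
  refine ⟨fun i j => if (f j).1 = i then 1 else 0, ?_, ?_, ?_, ?_⟩
  · intro i j
    dsimp only
    split_ifs <;> simp
  · intro i
    let h : ℕ → ℝ := fun k => Nat.casesOn k P (fun k => ∑ j, π j * w i k j)
    have hh0 : ∀ k, 0 ≤ h k := by
      rintro (_ | k)
      · exact hP0
      · exact sum_nonneg fun j _ => mul_nonneg (hπ j) (hw0 _ _ _)
    have hle : ∀ j, (f j).1 = i → π j ≤ h (f j).2 := by
      intro j hj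
      have h1 := hf' j
      subst hj
      generalize ((f j).2 : ℕ) = k at *
      cases k with
      | zero => exact hP j
      | succ k => exact hwπ _ k j h1
    calc (∑ j, π j * (if (f j).1 = i then (1:ℝ) else 0))
        = ∑ j ∈ univ.filter (fun j => (f j).1 = i), π j := by
          rw [sum_filter]; simp
      _ ≤ ∑ j ∈ univ.filter (fun j => (f j).1 = i), h (f j).2 := by
          refine sum_le_sum fun j hj => hle j (by simpa using hj)
      _ = ∑ k ∈ (univ.filter (fun j => (f j).1 = i)).image (fun j => ((f j).2 : ℕ)), h k := by
          rw [sum_image (hinj i)]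
      _ ≤ ∑ k ∈ range (c i + 1), h k := by
          apply sum_le_sum_of_subset_of_nonneg
          · intro k hk
            obtain ⟨j, hj, rfl⟩ := mem_image.1 hk
            have := hmem i j hj
            simp only [mem_range] at this ⊢
            omega
          · intro k _ _; exact hh0 k
      _ = (∑ k ∈ range (c i), ∑ j, π j * w i k j) + P := by
          rw [sum_range_succ']
          rfl
      _ = (∑ j, π j * u i j) + P := by
          rw [sum_comm]
          congr 1
          refine sum_congr rfl fun j _ => ?_
          rw [← mul_sum, hwu]
      _ ≤ t i + P := by linarith [hsize i]
  · intro i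
    have := card_le_card_of_injOn _ (hmem i) (hinj i)
    rw [card_range] at this
    simp only [sum_boole]
    exact_mod_cast this
  · intro j
    simp



theorem stmt6 (n m : ℕ) (hn : 0 < n) (hm : 0 < m)
    (π : Fin n → ℝ) (hπ : ∀ j, 0 ≤ π j)
    (c : Fin m → ℕ) (t : Fin m → ℝ) (ht : ∀ i, 0 ≤ t i)
    (hne : (Finset.univ : Finset (Fin n)).Nonempty)
    (u : Fin m → Fin n → ℝ)
    (hu01 : ∀ i j, 0 ≤ u i j ∧ u i j ≤ 1)
    (hsize : ∀ i, (∑ j, π j * u i j) ≤ t i)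
    (hcard : ∀ i, (∑ j, u i j) ≤ (c i : ℝ))
    (hassign : ∀ j, (∑ i, u i j) = 1) :
    ∃ u' : Fin m → Fin n → ℝ,
      (∀ i j, u' i j = 0 ∨ u' i j = 1) ∧
      (∀ i, (∑ j, π j * u' i j) ≤ t i + Finset.univ.sup' hne π) ∧
      (∀ i, (∑ j, u' i j) ≤ (c i : ℝ)) ∧
      (∀ j, (∑ i, u' i j) = 1) := by
  have hP : ∀ j, π j ≤ Finset.univ.sup' hne π := fun j => Finset.le_sup' π (mem_univ j)
  have hP0 : 0 ≤ Finset.univ.sup' hne π := (hπ ⟨0, hn⟩).trans (hP _)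
  let σ : Equiv.Perm (Fin n) := Tuple.sort (fun j => - π j)
  have hanti : Antitone (fun j => π (σ j)) := by
    intro a b hab
    have := Tuple.monotone_sort (fun j => - π j) hab
    simp only [Function.comp] at this
    exact neg_le_neg_iff.1 this
  obtain ⟨v, hv1, hv2, hv3, hv4⟩ := sorted_case n m (fun j => π (σ j)) (fun j => hπ _) hanti c t
    (Finset.univ.sup' hne π) hP0 (fun j => hP _) (fun i j => u i (σ j))
    (fun i j => (hu01 _ _).1)
    (fun i => by rw [Equiv.sum_comp σ (fun j => π j * u i j)]; exact hsize i)
    (fun i => by rw [Equiv.sum_comp σ (fun j => u i j)]; exact hcard i)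
    (fun j => hassign _)
  refine ⟨fun i j => v i (σ.symm j), fun i j => hv1 _ _, fun i => ?_, fun i => ?_, fun j => hv4 _⟩
  · rw [← Equiv.sum_comp σ]
    simpa using hv2 i
  · rw [Equiv.sum_comp σ.symm (fun j => v i j)]
    exact hv3 i
end

section
/- Fix ε ∈ (0,1] with 1/ε a positive integer, T > 0, a positive integer k, U ≥ 0, and m machines. Let J be a finite set of jobs, let S = {j ∈ J : p_j < εT} be the small jobs, let Lsiz be the set of distinct sizes of the large jobs (those with p_j ≥ εT), and let n_ℓ be the number of large jobs of size ℓ. Suppose x : C → ℕ (C the set of feasible configurations) and y, z : S × C → [0,1] satisfy: Σ_{c∈C} x_c = m; Σ_{c∈C} (y_{jc} + z_{jc}) = 1 for every j ∈ S; Σ_{j∈S} y_{jc}·p_j ≤ x_c·(β_c + 1)·εT for every c ∈ C; Σ_{j∈S} z_{jc}·p̃_j ≤ x_c·γ'_c·(γ_c + 1)·εT for every c ∈ C; Σ_{c∈C} α_{cℓ}·x_c = n_ℓ for every ℓ ∈ Lsiz; and x_c·Σ_{ℓ∈Lsiz} α_{cℓ} + Σ_{j∈S} y_{jc} ≤ x_c·δ_c·k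 for every c ∈ C. Then there exists a partition of J into m subsets each of load at most (1+3ε)·T. -/
open Finset

lemma aux_distribute {α β : Type*} [DecidableEq α] [DecidableEq β] [Nonempty β] (a : β → ℕ)
    (B : Finset β) : ∀ A : Finset α, (∑ b ∈ B, a b) = A.card →
    ∃ g : α → β, (∀ j ∈ A, g j ∈ B) ∧ ∀ b ∈ B, (A.filter fun j => g j = b).card = a b := by
  induction B using Finset.induction_on with
  | empty =>
    intro A h
    have hA : A = ∅ := by
      rw [← Finset.card_eq_zero, ← h]; simp
    subst hA
    exact ⟨fun _ => Classical.arbitrary β, by simp, by simp⟩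
  | insert b B hb ih =>
    intro A h
    rw [Finset.sum_insert hb] at h
    obtain ⟨A', hA', hc⟩ := Finset.exists_subset_card_eq (s := A) (n := a b) (by omega)
    obtain ⟨g, hg1, hg2⟩ := ih (A \ A') (by rw [Finset.card_sdiff_of_subset hA']; omega)
    refine ⟨fun j => if j ∈ A' then b else g j, ?_, ?_⟩
    · intro j hj
      by_cases hjA : j ∈ A'
      · simp [hjA]
      · simp only [hjA, if_false]
        exact Finset.mem_insert_of_mem (hg1 j (by simp [hj, hjA]))
    · intro b' hb'
      rcases Finset.mem_insert.1 hb' with rfl | hb'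
      · rw [← hc]
        congr 1
        ext j
        simp only [Finset.mem_filter]
        constructor
        · rintro ⟨hj, h2⟩
          by_contra hjA
          simp only [hjA, if_false] at h2
          exact hb (h2 ▸ hg1 j (by simp [hj, hjA]))
        · intro hj
          exact ⟨hA' hj, by simp [hj]⟩
      · rw [← hg2 b' hb']
        congr 1
        ext j
        simp only [Finset.mem_filter, Finset.mem_sdiff]
        have hne : b ≠ b' := fun h => hb (h ▸ hb')
        by_cases hjA : j ∈ A' <;> simp [hjA, hne]

noncomputable def auxG (s : ℕ) (t : ℝ) : ℝ := min (max (t - s) 0) 1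

lemma auxG_mono (s : ℕ) : Monotone (auxG s) := by
  intro a b h
  unfold auxG
  gcongr

lemma auxG_nonneg (s : ℕ) (t : ℝ) : 0 ≤ auxG s t := by
  unfold auxG; positivity

lemma auxG_le_one (s : ℕ) (t : ℝ) : auxG s t ≤ 1 := min_le_right _ _

lemma auxG_zero (s : ℕ) : auxG s 0 = 0 := by
  unfold auxG
  have : (0:ℝ) ≤ s := by positivity
  rw [max_eq_right (by linarith)]; simp

lemma auxG_eq_one (s : ℕ) (t : ℝ) (h : (s:ℝ) + 1 ≤ t) : auxG s t = 1 := by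
  unfold auxG
  apply min_eq_right
  exact le_trans (by linarith) (le_max_left _ _)

lemma auxG_eq_zero (s : ℕ) (t : ℝ) (h : t ≤ s) : auxG s t = 0 := by
  unfold auxG
  rw [max_eq_right (by linarith)]; simp

lemma auxG_sum' (t : ℝ) (ht : 0 ≤ t) (N : ℕ) : (∑ s ∈ range N, auxG s t) = min t N := by
  induction N with
  | zero => simp [ht]
  | succ N ih =>
    rw [Finset.sum_range_succ, ih]
    unfold auxG
    push_cast
    rcases le_total t N with h | h
    · rw [min_eq_left h, max_eq_right (by linarith), min_eq_left (by linarith), min_eq_left (by linarith)]; simp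
    · rw [min_eq_right h, max_eq_left (by linarith)]
      rcases le_total t (N+1) with h' | h'
      · rw [min_eq_left (by linarith), min_eq_left h']; ring
      · rw [min_eq_right (by linarith), min_eq_right h']

/-- Shmoys–Tardos rounding for jobs `0, …, n-1` sorted by decreasing size. -/
lemma aux_round {m n : ℕ} (p : ℕ → ℝ) (w : ℕ → Fin m → ℝ) (M : ℝ)
    (hp : ∀ r < n, 0 ≤ p r) (hM0 : 0 ≤ M) (hM : ∀ r < n, p r ≤ M)
    (hanti : ∀ r t, r ≤ t → t < n → p t ≤ p r)
    (hw : ∀ r < n, ∀ i, 0 ≤ w r i) (hw1 : ∀ r < n, ∑ i, w r i = 1) :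
    ∃ f : Fin n → Fin m, ∀ i,
      (∑ r ∈ univ.filter (fun r => f r = i), p r) ≤ (∑ r ∈ range n, w r i * p r) + M ∧
      (((univ.filter (fun r => f r = i)).card : ℕ) : ℝ) < (∑ r ∈ range n, w r i) + 1 := by
  classical
  set W : Fin m → ℕ → ℝ := fun i t => ∑ r ∈ range t, w r i with hW
  set o : ℕ → Fin m → ℕ → ℝ := fun r i s => auxG s (W i (r+1)) - auxG s (W i r) with ho
  have hWsucc : ∀ i r, W i (r+1) = W i r + w r i := fun i r => by
    simp only [hW, Finset.sum_range_succ]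
  have hWmono : ∀ i a b, a ≤ b → b ≤ n → W i a ≤ W i b := by
    intro i a b hab hbn
    apply Finset.sum_le_sum_of_subset_of_nonneg
    · intro r hr; simp at hr ⊢; omega
    · intro r hr _; simp at hr; exact hw r (by omega) i
  have hW0 : ∀ i a, a ≤ n → 0 ≤ W i a := by
    intro i a ha
    have := hWmono i 0 a (by omega) ha
    simpa [hW] using this
  have hwle : ∀ r < n, ∀ i, w r i ≤ 1 := by
    intro r hr i
    rw [← hw1 r hr]
    exact Finset.single_le_sum (fun i _ => hw r hr i) (Finset.mem_univ i)
  have hWn : ∀ i a, a ≤ n → W i a ≤ n := by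
    intro i a ha
    refine le_trans (hWmono i a n ha le_rfl) ?_
    calc W i n ≤ ∑ r ∈ range n, (1:ℝ) :=
          Finset.sum_le_sum (fun r hr => hwle r (Finset.mem_range.1 hr) i)
      _ = n := by simp
  have ho0 : ∀ r < n, ∀ i s, 0 ≤ o r i s := by
    intro r hr i s
    exact sub_nonneg.2 (auxG_mono s (hWmono i r (r+1) (by omega) (by omega)))
  have hosumr : ∀ i s, ∑ r ∈ range n, o r i s = auxG s (W i n) := by
    intro i s
    simp only [ho]
    rw [Finset.sum_range_sub (fun r => auxG s (W i r))]
    simp [hW, auxG_zero]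
  have hosums : ∀ r < n, ∀ i, ∑ s ∈ range n, o r i s = w r i := by
    intro r hr i
    simp only [ho]
    rw [Finset.sum_sub_distrib, auxG_sum' _ (hW0 i _ (by omega)), auxG_sum' _ (hW0 i _ (by omega)),
      min_eq_left (hWn i _ (by omega)), min_eq_left (hWn i _ (by omega)), hWsucc]
    ring
  let t : Fin n → Finset (Fin m × Fin n) := fun r => univ.filter fun q => 0 < o r q.1 q.2
  have hall : ∀ A : Finset (Fin n), A.card ≤ (A.biUnion t).card := by
    intro A
    have h1 : (A.card : ℝ) = ∑ r ∈ A, ∑ q ∈ A.biUnion t, o r q.1 q.2 := by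
      rw [Finset.card_eq_sum_ones]
      push_cast
      apply Finset.sum_congr rfl
      intro r hr
      have e1 : ∑ q ∈ A.biUnion t, o r q.1 q.2 = ∑ q : Fin m × Fin n, o r q.1 q.2 := by
        apply Finset.sum_subset (Finset.subset_univ _)
        intro q _ hq
        by_contra hne
        apply hq
        rw [Finset.mem_biUnion]
        refine ⟨r, hr, ?_⟩
        simp only [t, Finset.mem_filter, Finset.mem_univ, true_and]
        exact lt_of_le_of_ne (ho0 r r.2 _ _) (Ne.symm hne)
      rw [e1, Fintype.sum_prod_type, ← hw1 r r.2]
      apply Finset.sum_congr rfl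
      intro i _
      rw [← hosums r r.2 i, Finset.sum_range]
    have h2 : (∑ r ∈ A, ∑ q ∈ A.biUnion t, o r q.1 q.2) ≤ ((A.biUnion t).card : ℝ) := by
      rw [Finset.sum_comm, Finset.card_eq_sum_ones]
      push_cast
      apply Finset.sum_le_sum
      intro q _
      calc ∑ r ∈ A, o r q.1 q.2 ≤ ∑ r : Fin n, o r q.1 q.2 :=
            Finset.sum_le_sum_of_subset_of_nonneg (Finset.subset_univ _)
              (fun r _ _ => ho0 r r.2 _ _)
        _ = auxG q.2 (W q.1 n) := by rw [← hosumr, Finset.sum_range]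
        _ ≤ 1 := auxG_le_one _ _
    exact_mod_cast h1.le.trans h2
  obtain ⟨F, hFinj, hF⟩ := (Finset.all_card_le_biUnion_card_iff_exists_injective t).1 hall
  have hFo : ∀ r : Fin n, 0 < o r (F r).1 (F r).2 := by
    intro r
    have := hF r
    simpa [t] using this
  refine ⟨fun r => (F r).1, fun i => ?_⟩
  set R := univ.filter (fun r => (F r).1 = i) with hR
  have hRm : ∀ r ∈ R, 0 < o r i (F r).2 := by
    intro r hr
    have h := hFo r
    rw [(Finset.mem_filter.1 hr).2] at h
    exact h
  have hRpos : ∀ r ∈ R, (((F r).2 : ℕ) : ℝ) < W i (r+1) := by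
    intro r hr
    by_contra hcon
    push Not at hcon
    have h := hRm r hr
    simp only [ho] at h
    rw [auxG_eq_zero _ _ hcon] at h
    have := auxG_nonneg (F r).2 (W i r)
    linarith
  have hinj : Set.InjOn (fun r => ((F r).2 : ℕ)) (R : Set (Fin n)) := by
    intro a ha b hb hab
    apply hFinj
    have ha' := (Finset.mem_filter.1 (Finset.mem_coe.1 ha)).2
    have hb' := (Finset.mem_filter.1 (Finset.mem_coe.1 hb)).2
    exact Prod.ext (ha'.trans hb'.symm) (Fin.ext hab)
  constructor
  · -- size
    have key : ∀ r ∈ R, ((F r).2 : ℕ) ≠ 0 →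
        p r ≤ ∑ r' ∈ range n, o r' i ((F r).2 - 1) * p r' := by
      intro r hr hne
      obtain ⟨s, hs⟩ := Nat.exists_eq_succ_of_ne_zero hne
      have hlt := hRpos r hr
      rw [hs] at hlt ⊢
      simp only [Nat.succ_eq_add_one, Nat.add_sub_cancel]
      push_cast at hlt
      have h1 : ∑ r' ∈ range n, o r' i s = 1 := by
        rw [hosumr]
        apply auxG_eq_one
        exact hlt.le.trans (hWmono i _ _ r.2 le_rfl)
      calc p r = ∑ r' ∈ range n, o r' i s * p r := by rw [← Finset.sum_mul, h1, one_mul]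
        _ ≤ ∑ r' ∈ range n, o r' i s * p r' := by
          apply Finset.sum_le_sum
          intro r' hr'
          have hr'n := Finset.mem_range.1 hr'
          rcases le_or_gt r' r with hle | hgt
          · exact mul_le_mul_of_nonneg_left (hanti _ _ hle r.2) (ho0 _ hr'n _ _)
          · have hge : (s:ℝ) + 1 ≤ W i r' := hlt.le.trans (hWmono i _ _ hgt hr'n.le)
            have : o r' i s = 0 := by
              simp only [ho]
              rw [auxG_eq_one _ _ hge,
                auxG_eq_one _ _ (hge.trans (hWmono i _ _ (by omega) (by omega)))]
              ring
            rw [this]; simp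
    let c : ℕ → ℝ := fun s => if s = 0 then M else ∑ r' ∈ range n, o r' i (s-1) * p r'
    have hterm0 : ∀ s, 0 ≤ ∑ r' ∈ range n, o r' i s * p r' := fun s =>
      Finset.sum_nonneg fun r' hr' =>
        mul_nonneg (ho0 _ (Finset.mem_range.1 hr') _ _) (hp _ (Finset.mem_range.1 hr'))
    have hc0 : ∀ s, 0 ≤ c s := by
      intro s
      simp only [c]
      split_ifs
      · exact hM0
      · exact hterm0 _
    have hpc : ∀ r ∈ R, p r ≤ c (F r).2 := by
      intro r hr
      simp only [c]
      split_ifs with h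
      · exact hM r r.2
      · exact key r hr h
    calc ∑ r ∈ R, p r ≤ ∑ r ∈ R, c (F r).2 := Finset.sum_le_sum hpc
      _ = ∑ s ∈ R.image (fun r => ((F r).2 : ℕ)), c s := (Finset.sum_image hinj).symm
      _ ≤ ∑ s ∈ range (n+1), c s := by
          apply Finset.sum_le_sum_of_subset_of_nonneg
          · intro s hs
            obtain ⟨r, _, rfl⟩ := Finset.mem_image.1 hs
            have := (F r).2.2
            simp only [Finset.mem_range]; omega
          · intro s _ _; exact hc0 s
      _ = (∑ s ∈ range n, ∑ r' ∈ range n, o r' i s * p r') + M := by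
          rw [Finset.sum_range_succ']
          simp [c]
      _ = (∑ r ∈ range n, w r i * p r) + M := by
          rw [Finset.sum_comm]
          congr 1
          apply Finset.sum_congr rfl
          intro r hr
          rw [← Finset.sum_mul, hosums r (Finset.mem_range.1 hr)]
  · have hsub : R.image (fun r => ((F r).2 : ℕ)) ⊆ range ⌈W i n⌉₊ := by
      intro s hs
      obtain ⟨r, hr, rfl⟩ := Finset.mem_image.1 hs
      rw [Finset.mem_range, Nat.lt_ceil]
      exact (hRpos r hr).trans_le (hWmono i _ _ r.2 le_rfl)
    have hcard := Finset.card_le_card hsub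
    rw [Finset.card_image_of_injOn hinj, Finset.card_range] at hcard
    have h1 : (R.card : ℝ) ≤ (⌈W i n⌉₊ : ℝ) := by exact_mod_cast hcard
    exact h1.trans_lt (Nat.ceil_lt_add_one (hW0 i n le_rfl))

lemma aux_round_finset {ι : Type*} [DecidableEq ι] {m : ℕ} (hm : 0 < m) (S : Finset ι)
    (p : ι → ℝ) (w : ι → Fin m → ℝ) (M : ℝ)
    (hp : ∀ j ∈ S, 0 ≤ p j) (hM0 : 0 ≤ M) (hM : ∀ j ∈ S, p j ≤ M)
    (hw : ∀ j ∈ S, ∀ i, 0 ≤ w j i) (hw1 : ∀ j ∈ S, ∑ i, w j i = 1) :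
    ∃ f : ι → Fin m, ∀ i,
      (∑ j ∈ S.filter (fun j => f j = i), p j) ≤ (∑ j ∈ S, w j i * p j) + M ∧
      (((S.filter (fun j => f j = i)).card : ℕ) : ℝ) < (∑ j ∈ S, w j i) + 1 := by
  classical
  set n := S.card with hn
  let e0 : Fin n ≃ S := S.equivFin.symm
  let σ := Tuple.sort (fun r : Fin n => - p (e0 r))
  have hσ : Monotone ((fun r : Fin n => - p (e0 r)) ∘ σ) := Tuple.monotone_sort _
  let e : Fin n ≃ S := σ.trans e0
  have hanti : ∀ r t : Fin n, r ≤ t → p (e t) ≤ p (e r) := by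
    intro r t h
    have := hσ h
    simp only [Function.comp] at this
    simp only [e, Equiv.trans_apply]
    linarith
  let p' : ℕ → ℝ := fun r => if h : r < n then p (e ⟨r, h⟩) else 0
  let w' : ℕ → Fin m → ℝ := fun r i => if h : r < n then w (e ⟨r, h⟩) i else 0
  have hp' : ∀ r : Fin n, p' r = p (e r) := fun r => by simp [p']
  have hw' : ∀ (r : Fin n) i, w' r i = w (e r) i := fun r i => by simp [w']
  obtain ⟨f, hf⟩ := aux_round (n := n) p' w' M
    (fun r hr => by rw [hp' ⟨r, hr⟩]; exact hp _ (e _).2) hM0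
    (fun r hr => by rw [hp' ⟨r, hr⟩]; exact hM _ (e _).2)
    (fun r t hrt ht => by
      rw [hp' ⟨t, ht⟩, hp' ⟨r, by omega⟩]; exact hanti _ _ hrt)
    (fun r hr i => by rw [hw' ⟨r, hr⟩]; exact hw _ (e _).2 _)
    (fun r hr => by
      rw [← hw1 _ (e ⟨r, hr⟩).2]
      exact Finset.sum_congr rfl fun i _ => hw' ⟨r, hr⟩ i)
  have sum_e : ∀ φ : ι → ℝ, ∑ j ∈ S, φ j = ∑ r : Fin n, φ (e r) := by
    intro φ
    rw [← Finset.sum_coe_sort, ← Equiv.sum_comp e]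
  refine ⟨fun j => if h : j ∈ S then f (e.symm ⟨j, h⟩) else ⟨0, hm⟩, fun i => ?_⟩
  obtain ⟨h1, h2⟩ := hf i
  constructor
  · convert h1 using 1
    · rw [Finset.sum_filter, Finset.sum_filter, sum_e]
      apply Finset.sum_congr rfl
      intro r _
      simp [hp']
    · rw [sum_e, Finset.sum_range]
      simp [hp', hw']
  · convert h2 using 1
    · rw [Finset.card_filter, Finset.card_filter]
      push_cast
      rw [sum_e]
      apply Finset.sum_congr rfl
      intro r _
      simp
    · rw [sum_e, Finset.sum_range]
      simp [hw']

theorem stmt7 {ι : Type*} [DecidableEq ι]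
    (ε T U : ℝ) (E k m : ℕ)
    (hε : 0 < ε) (hε1 : ε ≤ 1) (hE : (E : ℝ) = 1 / ε) (hT : 0 < T)
    (hk : 0 < k) (hU : 0 ≤ U) (hm : 0 < m)
    (J : Finset ι) (p : ι → ℝ) (hp : ∀ j ∈ J, 0 ≤ p j)
    (Sma Lar : Finset ι)
    (hSma : Sma = J.filter fun j => p j < ε * T)
    (hLar : Lar = J.filter fun j => ε * T ≤ p j)
    (Lsiz : Finset ℝ) (hLsiz : Lsiz = Lar.image p)
    (F : Finset (SConfig Lsiz E)) (x : SConfig Lsiz E → ℕ)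
    (y z : ι → SConfig Lsiz E → ℝ)
    (hfeas : ∀ c ∈ F, sConfigLoad ε T U c ≤ T)
    (hx : (∑ c ∈ F, x c) = m)
    (hyz : ∀ j ∈ Sma, (∑ c ∈ F, (y j c + z j c)) = 1)
    (hyz01 : ∀ j ∈ Sma, ∀ c ∈ F, 0 ≤ y j c ∧ y j c ≤ 1 ∧ 0 ≤ z j c ∧ z j c ≤ 1)
    (hy : ∀ c ∈ F, (∑ j ∈ Sma, y j c * p j) ≤ (x c : ℝ) * ((c.beta : ℝ) + 1) * (ε * T))
    (hz : ∀ c ∈ F, (∑ j ∈ Sma, z j c * (p j + U / k)) ≤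
      (x c : ℝ) * (c.gammaP : ℝ) * ((c.gamma : ℝ) + 1) * (ε * T))
    (hα : ∀ ℓ : {ℓ // ℓ ∈ Lsiz},
      (∑ c ∈ F, c.alpha ℓ * x c) = (Lar.filter fun j => p j = (ℓ : ℝ)).card)
    (hδ : ∀ c ∈ F, (x c : ℝ) * (∑ ℓ ∈ Lsiz.attach, (c.alpha ℓ : ℝ)) + (∑ j ∈ Sma, y j c) ≤
      (x c : ℝ) * (c.delta : ℝ) * k) :
    ∃ P : Fin m → Finset ι,
      (∀ a b : Fin m, a ≠ b → Disjoint (P a) (P b)) ∧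
      Finset.univ.biUnion P = J ∧
      ∀ a, supLoad k U p (P a) ≤ (1 + 3 * ε) * T := by
  classical
  have hεT : 0 < ε * T := mul_pos hε hT
  have hk' : (0:ℝ) < k := by exact_mod_cast hk
  set q : ℝ := U / k with hq
  have hq0 : 0 ≤ q := div_nonneg hU hk'.le
  have hqk : q * k = U := by rw [hq]; field_simp
  have hSJ : ∀ j ∈ Sma, j ∈ J ∧ p j < ε * T := by
    intro j hj; rw [hSma] at hj; simpa using hj
  have hLJ : ∀ j ∈ Lar, j ∈ J ∧ ε * T ≤ p j := by
    intro j hj; rw [hLar] at hj; simpa using hj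
  have hpS : ∀ j ∈ Sma, 0 ≤ p j := fun j hj => hp j (hSJ j hj).1
  have hFne : F.Nonempty := by
    rw [Finset.nonempty_iff_ne_empty]
    rintro rfl
    simp at hx; omega
  have : Nonempty (SConfig Lsiz E) := ⟨hFne.choose⟩
  have : Nonempty (Fin m) := ⟨⟨0, hm⟩⟩
  obtain ⟨cf, hcfF, hcfx⟩ := aux_distribute x F (Finset.univ : Finset (Fin m)) (by simpa using hx)
  replace hcfF : ∀ i, cf i ∈ F := fun i => hcfF i (Finset.mem_univ i)
  have hxpos : ∀ i, 0 < x (cf i) := by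
    intro i
    rw [← hcfx _ (hcfF i), Finset.card_pos]
    exact ⟨i, by simp⟩
  have sum_cf : ∀ φ : SConfig Lsiz E → ℝ, ∑ i, φ (cf i) = ∑ c ∈ F, (x c : ℝ) * φ c := by
    intro φ
    rw [← Finset.sum_fiberwise_of_maps_to (g := cf) (t := F) (fun i _ => hcfF i)]
    apply Finset.sum_congr rfl
    intro c hc
    rw [← hcfx c hc, Finset.sum_congr rfl (g := fun _ => φ c)]
    · simp
    · intro i hi; rw [(Finset.mem_filter.1 hi).2]
  have sum_cfN : ∀ φ : SConfig Lsiz E → ℕ, ∑ i, φ (cf i) = ∑ c ∈ F, φ c * x c := by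
    intro φ
    have := sum_cf (fun c => (φ c : ℝ))
    have h2 : ((∑ i, φ (cf i) : ℕ) : ℝ) = ((∑ c ∈ F, φ c * x c : ℕ) : ℝ) := by
      push_cast
      rw [this]
      exact Finset.sum_congr rfl fun c _ => mul_comm _ _
    exact_mod_cast h2
  -- large jobs
  have hlarge : ∀ ℓ : {ℓ // ℓ ∈ Lsiz}, ∃ g : ι → Fin m, ∀ i,
      ((Lar.filter fun j => p j = (ℓ : ℝ)).filter fun j => g j = i).card = (cf i).alpha ℓ := by
    intro ℓ
    obtain ⟨g, _, hg⟩ := aux_distribute (fun i => (cf i).alpha ℓ) (Finset.univ : Finset (Fin m))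
      (Lar.filter fun j => p j = (ℓ : ℝ)) (by
        rw [← hα ℓ]; exact sum_cfN (fun c => c.alpha ℓ))
    exact ⟨g, fun i => hg i (Finset.mem_univ i)⟩
  choose G hG using hlarge
  -- small jobs
  let w : ι → Fin m → ℝ := fun j i =>
    if p j + q = 0 then 1 / (m:ℝ) else (y j (cf i) + z j (cf i)) / x (cf i)
  have hm' : (0:ℝ) < m := by exact_mod_cast hm
  have hw0 : ∀ j ∈ Sma, ∀ i, 0 ≤ w j i := by
    intro j hj i
    obtain ⟨a, _, b, _⟩ := hyz01 j hj _ (hcfF i)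
    simp only [w]
    split_ifs <;> positivity
  have hzero : ∀ j ∈ Sma, p j + q ≠ 0 → ∀ c ∈ F, x c = 0 → y j c + z j c = 0 := by
    intro j hj hne c hc hxc
    have h1 := hδ c hc
    have h2 := hz c hc
    simp only [hxc, Nat.cast_zero, zero_mul, zero_add] at h1 h2
    have hyj : y j c ≤ ∑ j ∈ Sma, y j c :=
      Finset.single_le_sum (f := fun j => y j c) (fun j hj => (hyz01 j hj c hc).1) hj
    have hzj : z j c * (p j + q) ≤ ∑ j ∈ Sma, z j c * (p j + q) :=
      Finset.single_le_sum (f := fun j => z j c * (p j + q))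
        (fun j hj => mul_nonneg (hyz01 j hj c hc).2.2.1 (add_nonneg (hpS j hj) hq0)) hj
    have hpos : 0 < p j + q := lt_of_le_of_ne (add_nonneg (hpS j hj) hq0) (Ne.symm hne)
    obtain ⟨a, _, b, _⟩ := hyz01 j hj c hc
    have hzz : z j c ≤ 0 := by
      by_contra hcon
      push Not at hcon
      have := mul_pos hcon hpos
      linarith
    linarith
  have hw1 : ∀ j ∈ Sma, ∑ i, w j i = 1 := by
    intro j hj
    by_cases hne : p j + q = 0
    · simp only [w, hne, if_true]
      simp [hm'.ne']
    · simp only [w, hne, if_false]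
      rw [sum_cf (fun c => (y j c + z j c) / x c), ← hyz j hj]
      apply Finset.sum_congr rfl
      intro c hc
      by_cases hxc : x c = 0
      · rw [hzero j hj hne c hc hxc]; simp
      · have : (x c : ℝ) ≠ 0 := by exact_mod_cast hxc
        field_simp
  obtain ⟨f, hf⟩ := aux_round_finset hm Sma p w (ε * T) hpS hεT.le
    (fun j hj => (hSJ j hj).2.le) hw0 hw1
  let h : ι → Fin m := fun j =>
    if p j < ε * T then f j else if hl : p j ∈ Lsiz then G ⟨p j, hl⟩ j else ⟨0, hm⟩
  refine ⟨fun i => J.filter fun j => h j = i, ?_, ?_, ?_⟩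
  · intro a b hab
    rw [Finset.disjoint_filter]
    intro j _ h1 h2
    exact hab (h1.symm.trans h2)
  · ext j
    simp
  intro i
  set c := cf i with hc
  have hcF := hcfF i
  have hx0 : (0:ℝ) < x c := by exact_mod_cast hxpos i
  have hsplit : (J.filter fun j => h j = i) =
      (Lar.filter fun j => h j = i) ∪ (Sma.filter fun j => f j = i) := by
    ext j
    simp only [hLar, hSma, Finset.mem_filter, Finset.mem_union]
    by_cases hjs : p j < ε * T
    · simp [hjs, h]
    · simp [hjs, not_lt.1 hjs]
  have hdisj : Disjoint (Lar.filter fun j => h j = i) (Sma.filter fun j => f j = i) := by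
    rw [Finset.disjoint_left]
    intro j h1 h2
    have a1 := (hLJ j (Finset.mem_filter.1 h1).1).2
    have a2 := (hSJ j (Finset.mem_filter.1 h2).1).2
    linarith
  have hfib : ∀ ℓ : {ℓ // ℓ ∈ Lsiz},
      ((Lar.filter fun j => h j = i).filter fun j => p j = (ℓ : ℝ)).card = c.alpha ℓ := by
    intro ℓ
    rw [hc, ← hG ℓ i]
    congr 1
    ext j
    simp only [Finset.mem_filter]
    constructor
    · rintro ⟨⟨h1, h2⟩, h3⟩
      refine ⟨⟨h1, h3⟩, ?_⟩
      rw [← h2]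
      have : ¬ p j < ε * T := not_lt.2 (hLJ j h1).2
      have hm2 : p j ∈ Lsiz := h3 ▸ ℓ.2
      have hℓ : ℓ = ⟨p j, hm2⟩ := Subtype.ext h3.symm
      simp only [h, this, if_false, hm2, dif_pos, hℓ]
    · rintro ⟨⟨h1, h3⟩, h2⟩
      refine ⟨⟨h1, ?_⟩, h3⟩
      rw [← h2]
      have : ¬ p j < ε * T := not_lt.2 (hLJ j h1).2
      have hm2 : p j ∈ Lsiz := h3 ▸ ℓ.2
      have hℓ : ℓ = ⟨p j, hm2⟩ := Subtype.ext h3.symm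
      simp only [h, this, if_false, hm2, dif_pos, hℓ]
  have hmaps : ∀ j ∈ Lar.filter (fun j => h j = i), p j ∈ Lsiz := by
    intro j hj
    rw [hLsiz]
    exact Finset.mem_image_of_mem _ (Finset.mem_filter.1 hj).1
  have hLsum : ∑ j ∈ Lar.filter (fun j => h j = i), p j =
      ∑ ℓ ∈ Lsiz.attach, (ℓ : ℝ) * (c.alpha ℓ : ℝ) := by
    rw [← Finset.sum_fiberwise_of_maps_to hmaps, ← Finset.sum_attach]
    apply Finset.sum_congr rfl
    intro ℓ _
    rw [← hfib ℓ, Finset.sum_congr rfl (g := fun _ => (ℓ : ℝ))]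
    · simp [mul_comm]
    · intro j hj; exact (Finset.mem_filter.1 hj).2
  have hLcard : ((Lar.filter (fun j => h j = i)).card : ℝ) =
      ∑ ℓ ∈ Lsiz.attach, (c.alpha ℓ : ℝ) := by
    rw [Finset.card_eq_sum_card_fiberwise hmaps, ← Finset.sum_attach]
    push_cast
    apply Finset.sum_congr rfl
    intro ℓ _
    rw [← hfib ℓ]
  obtain ⟨hf1, hf2⟩ := hf i
  have hfe := hfeas c hcF
  unfold sConfigLoad at hfe
  unfold supLoad
  beta_reduce
  rw [hsplit, Finset.sum_union hdisj, Finset.card_union_of_disjoint hdisj, hLsum]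
  set nL := (Lar.filter (fun j => h j = i)).card
  set nS := (Sma.filter (fun j => f j = i)).card
  set PL := ∑ ℓ ∈ Lsiz.attach, (ℓ : ℝ) * (c.alpha ℓ : ℝ)
  set PS := ∑ j ∈ Sma.filter (fun j => f j = i), p j
  -- fractional quantities per machine
  set Yp := (∑ j ∈ Sma, y j c * p j) / x c with hYp
  set Zp := (∑ j ∈ Sma, z j c * p j) / x c with hZp
  set Ys := (∑ j ∈ Sma, y j c) / x c with hYs
  set Zs := (∑ j ∈ Sma, z j c) / x c with hZs
  have hZs0 : 0 ≤ Zs := div_nonneg (Finset.sum_nonneg fun j hj => (hyz01 j hj c hcF).2.2.1) hx0.le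
  have hZp0 : 0 ≤ Zp := div_nonneg (Finset.sum_nonneg fun j hj =>
    mul_nonneg (hyz01 j hj c hcF).2.2.1 (hpS j hj)) hx0.le
  have b1 : Yp ≤ ((c.beta : ℝ) + 1) * (ε * T) := by
    rw [hYp, div_le_iff₀ hx0]
    linarith [hy c hcF]
  have b2 : Zp + q * Zs ≤ (c.gammaP : ℝ) * ((c.gamma : ℝ) + 1) * (ε * T) := by
    have e : Zp + q * Zs = (∑ j ∈ Sma, z j c * (p j + q)) / x c := by
      simp only [mul_add, Finset.sum_add_distrib, ← Finset.sum_mul]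
      rw [hZp, hZs]; ring
    rw [e, div_le_iff₀ hx0]
    linarith [hz c hcF]
  have b3 : (nL : ℝ) + Ys ≤ (c.delta : ℝ) * k := by
    have e := hδ c hcF
    rw [← hLcard] at e
    have e2 : (∑ j ∈ Sma, y j c) = Ys * x c := by rw [hYs]; field_simp
    rw [e2] at e
    have : (x c : ℝ) * ((nL : ℝ) + Ys) ≤ x c * ((c.delta : ℝ) * k) := by linarith
    exact le_of_mul_le_mul_left this hx0
  have b4 : PS ≤ Yp + Zp + ε * T := by
    refine hf1.trans (add_le_add_left (le_of_eq ?_) _)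
    rw [hYp, hZp, ← add_div, ← Finset.sum_add_distrib, Finset.sum_div]
    apply Finset.sum_congr rfl
    intro j hj
    by_cases hne : p j + q = 0
    · have : p j = 0 := by linarith [hpS j hj]
      simp [this]
    · simp only [w, hne, if_false]
      rw [← hc]; ring
  have hd1 : (1:ℝ) ≤ c.delta := by exact_mod_cast c.one_le_delta
  have b5 : 0 < U → (nL : ℝ) + nS < c.delta * k + Zs + 1 := by
    intro hU0
    have hq1 : 0 < q := div_pos hU0 hk'
    have e : ∑ j ∈ Sma, w j i = Ys + Zs := by
      rw [hYs, hZs, ← add_div, ← Finset.sum_add_distrib, Finset.sum_div]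
      apply Finset.sum_congr rfl
      intro j hj
      have hne : p j + q ≠ 0 := by linarith [hpS j hj]
      simp only [w, hne, if_false]
      rw [← hc]
    rw [e] at hf2
    linarith
  have hβ0 : (0:ℝ) ≤ c.beta := Nat.cast_nonneg _
  have hgam := c.gammaP_le_one
  have b6 : (((nL + nS - 1) / k : ℕ) : ℝ) * U ≤ U * ((c.delta : ℝ) - 1 + c.gammaP) + q * Zs := by
    rcases hU.eq_or_lt with hU0 | hU0
    · have : q = 0 := by rw [hq, ← hU0]; simp
      rw [← hU0, this]; simp
    have b5 := b5 hU0
    have hq1 : 0 < q := div_pos hU0 hk'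
    interval_cases hgp : c.gammaP
    · have hZ : Zs = 0 := by
        have h1 : q * Zs ≤ 0 := by
          push_cast at b2; linarith
        by_contra hcon
        have := mul_pos hq1 (lt_of_le_of_ne hZs0 (Ne.symm hcon))
        linarith
      rw [hZ] at b5 ⊢
      have hn : nL + nS < c.delta * k + 1 := by
        have : ((nL + nS : ℕ) : ℝ) < ((c.delta * k + 1 : ℕ) : ℝ) := by push_cast; linarith
        exact_mod_cast this
      have hdk : 1 ≤ c.delta * k := Nat.mul_pos c.one_le_delta hk
      have hdiv : (nL + nS - 1) / k < c.delta := by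
        rw [Nat.div_lt_iff_lt_mul hk]; omega
      have : (((nL + nS - 1) / k : ℕ) : ℝ) + 1 ≤ c.delta := by exact_mod_cast hdiv
      have h3 : (((nL + nS - 1) / k : ℕ) : ℝ) ≤ c.delta - 1 := by linarith
      have := mul_le_mul_of_nonneg_right h3 hU
      push_cast
      linarith
    · have hn : ((nL + nS - 1 : ℕ) : ℝ) ≤ c.delta * k + Zs := by
        rcases Nat.eq_zero_or_pos (nL + nS) with h0 | h0
        · rw [h0]; simp; positivity
        · rw [Nat.cast_sub h0]; push_cast; linarith
      have hdiv : (((nL + nS - 1) / k : ℕ) : ℝ) ≤ ((nL + nS - 1 : ℕ) : ℝ) / k := Nat.cast_div_le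
      have h4 : (((nL + nS - 1) / k : ℕ) : ℝ) * k ≤ c.delta * k + Zs := by
        rw [le_div_iff₀ hk'] at hdiv
        linarith
      have h5 := mul_le_mul_of_nonneg_left h4 hq0
      have h6 : q * ((((nL + nS - 1) / k : ℕ) : ℝ) * k) = (((nL + nS - 1) / k : ℕ) : ℝ) * U := by
        rw [← hqk]; ring
      have h7 : q * (c.delta * k + Zs) = U * c.delta + q * Zs := by rw [← hqk]; ring
      push_cast
      linarith
  have b7 : (c.gammaP : ℝ) * (ε * T) ≤ ε * T := by
    have : (c.gammaP : ℝ) ≤ 1 := by exact_mod_cast hgam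
    nlinarith
  linarith
end

section
/- Let ε ∈ (0,1] with 1/ε³ a positive integer, let k be a positive integer, and let U ∈ (0,1]. List the n items as s_1 ≥ s_2 ≥ … ≥ s_n and partition them into 1/ε³ classes I_1, …, I_{1/ε³} of consecutive items in this order with ⌈ε³n⌉ = |I_1| ≥ |I_2| ≥ … ≥ |I_{1/ε³}| = ⌊ε³n⌋. Let the rounded instance consist of, for each i ≥ 2 and each item of class I_i, one item of size s(I_i), where s(I_i) is the largest item size in class I_i. If the original n items admit a feasible packing into N bins, then the rounded instance admits a feasible packing into at most N bins. -/
open Finset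

/-- The load of a bin in BPU: total item size plus `⌊(|b|−1)/k⌋` idle items of size `U`. -/
noncomputable def binLoad {ι : Type*} (k : ℕ) (U : ℝ) (s : ι → ℝ) (b : Finset ι) : ℝ :=
  (∑ i ∈ b, s i) + (((b.card - 1) / k : ℕ) : ℝ) * U

/-- A feasible packing of the items of `J` into at most `N` bins:
a partition of `J` into `N` (possibly empty) bins each of load at most `1`. -/
def HasPacking {ι : Type*} [DecidableEq ι] (k : ℕ) (U : ℝ) (s : ι → ℝ)
    (J : Finset ι) (N : ℕ) : Prop :=
  ∃ P : Fin N → Finset ι,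
    (∀ a b : Fin N, a ≠ b → Disjoint (P a) (P b)) ∧
    Finset.univ.biUnion P = J ∧
    ∀ a, binLoad k U s (P a) ≤ 1

theorem stmt9 (ε : ℝ) (E3 : ℕ) (hε : 0 < ε) (hε1 : ε ≤ 1) (hE3 : (E3 : ℝ) = 1 / ε ^ 3)
    (k : ℕ) (hk : 0 < k) (U : ℝ) (hU : 0 < U) (hU1 : U ≤ 1)
    (n : ℕ) (s : Fin n → ℝ) (hs : ∀ i, 0 ≤ s i ∧ s i ≤ 1)
    -- the items are listed in non-increasing order of size
    (hsort : Antitone s)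
    -- `q i` is the (1-based) index of the class of item `i`; classes are blocks of
    -- consecutive items in the sorted order
    (q : Fin n → ℕ) (hq : ∀ i, 1 ≤ q i ∧ q i ≤ E3) (hqmono : Monotone q)
    (hcard1 : (Finset.univ.filter fun i => q i = 1).card = ⌈ε ^ 3 * n⌉₊)
    (hcardE : (Finset.univ.filter fun i => q i = E3).card = ⌊ε ^ 3 * n⌋₊)
    (hcardanti : ∀ c c' : ℕ, 1 ≤ c → c ≤ c' → c' ≤ E3 →
      (Finset.univ.filter fun i => q i = c').card ≤
        (Finset.univ.filter fun i => q i = c).card)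
    -- rounded sizes: each item of a class other than the first gets the largest
    -- size of its class
    (s' : Fin n → ℝ)
    (hs' : ∀ i, q i ≠ 1 →
      ∃ j, q j = q i ∧ s' i = s j ∧ ∀ j', q j' = q i → s j' ≤ s j)
    (N : ℕ) (hpack : HasPacking k U s Finset.univ N) :
    HasPacking k U s' (Finset.univ.filter fun i => q i ≠ 1) N := by
  classical
  obtain ⟨P, hdisj, hun, hload⟩ := hpack
  set m := (Finset.univ.filter fun i => q i = 1).card with hm
  have him : ∀ i, q i ≠ 1 → m ≤ i.val := by
    intro i hi
    have h : (Finset.univ.filter fun i => q i = 1) ⊆ Finset.Iio i := by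
      intro j hj
      simp only [Finset.mem_filter, Finset.mem_univ, true_and] at hj
      rw [Finset.mem_Iio]
      by_contra hc
      have h1 := hqmono (not_lt.mp hc)
      have h2 := (hq i).1
      omega
    have h3 := Finset.card_le_card h
    rwa [Fin.card_Iio] at h3
  let f : Fin n → Fin n := fun i => ⟨i.val - m, by have := i.isLt; omega⟩
  have hfle : ∀ i, q i ≠ 1 → s' i ≤ s (f i) := by
    intro i hi
    obtain ⟨j, hj, hsj, -⟩ := hs' i hi
    rw [hsj]
    apply hsort
    by_contra hc
    have hjf : j ≤ f i := (not_le.mp hc).le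
    have hfi : f i ≤ i := by
      show i.val - m ≤ i.val
      omega
    have h1 : Finset.Icc (f i) i ⊆ Finset.univ.filter fun x => q x = q i := by
      intro x hx
      rw [Finset.mem_Icc] at hx
      simp only [Finset.mem_filter, Finset.mem_univ, true_and]
      have h1 := hqmono hx.1
      have h2 := hqmono hx.2
      have h3 := hqmono hjf
      omega
    have h2 := Finset.card_le_card h1
    have h3 := hcardanti 1 (q i) le_rfl (hq i).1 (hq i).2
    have h4 := him i hi
    rw [Fin.card_Icc] at h2
    have h5 : (f i).val = i.val - m := rfl
    omega
  have hinj : ∀ i j, q i ≠ 1 → q j ≠ 1 → f i = f j → i = j := by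
    intro i j hi hj h
    have h1 := him i hi
    have h2 := him j hj
    have h3 : i.val - m = j.val - m := congrArg Fin.val h
    apply Fin.ext
    omega
  refine ⟨fun a => Finset.univ.filter fun i => q i ≠ 1 ∧ f i ∈ P a, ?_, ?_, ?_⟩
  · intro a b hab
    rw [Finset.disjoint_left]
    intro x hx hy
    simp only [Finset.mem_filter, Finset.mem_univ, true_and] at hx hy
    exact Finset.disjoint_left.mp (hdisj a b hab) hx.2 hy.2
  · ext x
    have hx : f x ∈ Finset.univ.biUnion P := by rw [hun]; exact Finset.mem_univ _
    simp only [Finset.mem_biUnion, Finset.mem_filter, Finset.mem_univ, true_and] at hx ⊢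
    obtain ⟨a, ha⟩ := hx
    exact ⟨fun ⟨_, h⟩ => h.1, fun h => ⟨a, h, ha⟩⟩
  · intro a
    refine le_trans ?_ (hload a)
    set Q := Finset.univ.filter fun i => q i ≠ 1 ∧ f i ∈ P a with hQ
    have hQm : ∀ i ∈ Q, q i ≠ 1 ∧ f i ∈ P a := by
      intro i hi
      simpa [hQ] using hi
    have hio : Set.InjOn f Q := fun i hi j hj h =>
      hinj i j (hQm i hi).1 (hQm j hj).1 h
    have hsub : Q.image f ⊆ P a := by
      intro x hx
      obtain ⟨i, hi, rfl⟩ := Finset.mem_image.mp hx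
      exact (hQm i hi).2
    have hc : Q.card ≤ (P a).card := by
      rw [← Finset.card_image_of_injOn hio]
      exact Finset.card_le_card hsub
    have hsum : ∑ i ∈ Q, s' i ≤ ∑ i ∈ P a, s i := by
      calc ∑ i ∈ Q, s' i ≤ ∑ i ∈ Q, s (f i) :=
            Finset.sum_le_sum fun i hi => hfle i (hQm i hi).1
        _ = ∑ x ∈ Q.image f, s x := (Finset.sum_image hio).symm
        _ ≤ ∑ i ∈ P a, s i :=
            Finset.sum_le_sum_of_subset_of_nonneg hsub fun i _ _ => (hs i).1
    have hd : (((Q.card - 1) / k : ℕ) : ℝ) ≤ ((((P a).card - 1) / k : ℕ) : ℝ) := by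
      exact_mod_cast Nat.div_le_div_right (Nat.sub_le_sub_right hc 1)
    unfold binLoad
    exact add_le_add hsum (mul_le_mul_of_nonneg_right hd hU.le)
end

section
/- Let ε ∈ (0,1], let k be a positive integer, let U ∈ (0,1], and suppose ⌊k/U⌋ + k ≤ 1/ε². Suppose n items with sizes in [0,1] admit a feasible packing into OPT bins, and let I_1 be a subset of the items with |I_1| ≤ ε³·n + 1. Then |I_1| ≤ ε·OPT + 1; in particular, packing each item of I_1 into its own bin yields a feasible packing of I_1 into at most ε·OPT + 1 bins. -/
open Finset

theorem stmt10 {ι : Type*} [DecidableEq ι] (ε : ℝ) (hε : 0 < ε) (hε1 : ε ≤ 1)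
    (k : ℕ) (hk : 0 < k) (U : ℝ) (hU : 0 < U) (hU1 : U ≤ 1)
    (hcb : ((⌊(k : ℝ) / U⌋₊ + k : ℕ) : ℝ) ≤ 1 / ε ^ 2)
    (J : Finset ι) (s : ι → ℝ) (hs : ∀ i ∈ J, 0 ≤ s i ∧ s i ≤ 1)
    (OPT : ℕ) (hpack : HasPacking k U s J OPT)
    (I1 : Finset ι) (hI1 : I1 ⊆ J) (hI1card : (I1.card : ℝ) ≤ ε ^ 3 * J.card + 1) :
    (I1.card : ℝ) ≤ ε * OPT + 1 ∧
    ∃ M : ℕ, (M : ℝ) ≤ ε * OPT + 1 ∧ HasPacking k U s I1 M := by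

  have hcard : (J.card : ℝ) ≤ OPT * (1 / ε ^ 2) := by
    obtain ⟨P, -, hU', hload⟩ := hpack
    have hb : ∀ a, (P a).card ≤ ⌊(k : ℝ) / U⌋₊ + k := by
      intro a
      have hsum : 0 ≤ ∑ i ∈ P a, s i := by
        apply Finset.sum_nonneg
        intro i hi
        refine (hs i ?_).1
        rw [← hU']
        exact Finset.mem_biUnion.2 ⟨a, Finset.mem_univ a, hi⟩
      have hl := hload a
      unfold binLoad at hl
      have hq : ((((P a).card - 1) / k : ℕ) : ℝ) * U ≤ 1 := by linarith
      have h1 : k * (((P a).card - 1) / k) ≤ ⌊(k : ℝ) / U⌋₊ := by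
        apply Nat.le_floor
        rw [le_div_iff₀ hU, Nat.cast_mul, mul_assoc]
        have hk0 : (0 : ℝ) ≤ k := Nat.cast_nonneg k
        nlinarith
      have h2 := Nat.div_add_mod ((P a).card - 1) k
      have h3 := Nat.mod_lt ((P a).card - 1) hk
      omega
    have h4 : J.card ≤ OPT * (⌊(k : ℝ) / U⌋₊ + k) := by
      rw [← hU']
      refine Finset.card_biUnion_le.trans ?_
      refine (Finset.sum_le_card_nsmul _ _ _ (fun a _ => hb a)).trans ?_
      simp
    calc (J.card : ℝ) ≤ ((OPT * (⌊(k : ℝ) / U⌋₊ + k) : ℕ) : ℝ) := by exact_mod_cast h4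
      _ = OPT * ((⌊(k : ℝ) / U⌋₊ + k : ℕ) : ℝ) := by rw [Nat.cast_mul]
      _ ≤ _ := by gcongr
  have hmain : (I1.card : ℝ) ≤ ε * OPT + 1 := by
    have h5 : ε ^ 3 * (J.card : ℝ) ≤ ε ^ 3 * (OPT * (1 / ε ^ 2)) := by gcongr
    have h6 : ε ^ 3 * (OPT * (1 / ε ^ 2)) = ε * OPT := by field_simp
    linarith
  refine ⟨hmain, I1.card, hmain, fun a => {(I1.equivFin.symm a : ι)}, ?_, ?_, ?_⟩
  · intro a b hab
    rw [Finset.disjoint_singleton]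
    intro h
    exact hab (I1.equivFin.symm.injective (Subtype.ext h))
  · ext x
    simp only [Finset.mem_biUnion, Finset.mem_univ, true_and, Finset.mem_singleton]
    constructor
    · rintro ⟨a, rfl⟩
      exact (I1.equivFin.symm a).2
    · intro hx
      exact ⟨I1.equivFin ⟨x, hx⟩, by simp⟩
  · intro a
    simpa [binLoad] using (hs _ (hI1 (I1.equivFin.symm a).2)).2
end

section
/- Let ε ∈ (0,1] with 1/ε³ a positive integer, let k be a positive integer, and let U ∈ (0,1]. Partition the items into large items (size at least ε) and small items (size less than ε). List the large items as s_1 ≥ … ≥ s_{|L|} and partition them into 1/ε³ classes L_1, …, L_{1/ε³} of consecutive items in this order with ⌈ε³|L|⌉ = |L_1| ≥ |L_2| ≥ … ≥ |L_{1/ε³}| = ⌊ε³|L|⌋. Let the rounded instance consist of all small items unchanged together with, for each i ≥ 2 and each large item of class L_i, one item of size s(L_i), where s(L_i) is the largest item size in class L_i. If the original item set admits a feasible packing into N bins, then the rounded instance admits a feasible packing into at most N bins. -/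
open Finset

theorem exists_inj_aux {ι : Type*} [DecidableEq ι] (A B : Finset ι) (h : A.card ≤ B.card) :
    ∃ g : ι → ι, (∀ x ∈ A, g x ∈ B) ∧ ∀ x ∈ A, ∀ y ∈ A, g x = g y → x = y := by
  have h' : Fintype.card A ≤ Fintype.card B := by simpa using h
  obtain ⟨e⟩ := Function.Embedding.nonempty_of_card_le h'
  refine ⟨fun x => if hx : x ∈ A then (e ⟨x, hx⟩ : ι) else x, ?_, ?_⟩
  · intro x hx
    simp only [hx, dite_true]
    exact (e ⟨x, hx⟩).2
  · intro x hx y hy hxy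
    simp only [hx, hy, dite_true] at hxy
    have := e.injective (Subtype.ext hxy)
    simpa using this

theorem packing_aux {ι : Type*} [DecidableEq ι] (k : ℕ) (U : ℝ) (hU : 0 < U)
    (J J' : Finset ι) (s s' : ι → ℝ) (hs : ∀ i ∈ J, 0 ≤ s i) (f : ι → ι)
    (hf : ∀ x ∈ J', f x ∈ J) (hinj : ∀ x ∈ J', ∀ y ∈ J', f x = f y → x = y)
    (hle : ∀ x ∈ J', s' x ≤ s (f x)) (N : ℕ) (hpack : HasPacking k U s J N) :
    HasPacking k U s' J' N := by
  obtain ⟨P, hd, hu, hl⟩ := hpack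
  refine ⟨fun a => J'.filter fun x => f x ∈ P a, ?_, ?_, ?_⟩
  · intro a b hab
    rw [Finset.disjoint_left]
    intro x hx hy
    exact (Finset.disjoint_left.mp (hd a b hab)) (Finset.mem_filter.mp hx).2
      (Finset.mem_filter.mp hy).2
  · ext x
    simp only [Finset.mem_biUnion, Finset.mem_univ, true_and, Finset.mem_filter]
    constructor
    · rintro ⟨a, h, _⟩
      exact h
    · intro h
      have := hf x h
      rw [← hu] at this
      simp only [Finset.mem_biUnion, Finset.mem_univ, true_and] at this
      obtain ⟨a, ha⟩ := this
      exact ⟨a, h, ha⟩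
  · intro a
    refine le_trans ?_ (hl a)
    set Q := J'.filter fun x => f x ∈ P a with hQ
    have hQJ : ∀ x ∈ Q, x ∈ J' ∧ f x ∈ P a := fun x hx => Finset.mem_filter.mp hx
    have hio : Set.InjOn f (Q : Set ι) := fun x hx y hy h =>
      hinj x (hQJ x hx).1 y (hQJ y hy).1 h
    have hsub : Q.image f ⊆ P a := by
      intro y hy
      obtain ⟨x, hx, rfl⟩ := Finset.mem_image.mp hy
      exact (hQJ x hx).2
    have hc : Q.card ≤ (P a).card := by
      rw [← Finset.card_image_of_injOn hio]
      exact Finset.card_le_card hsub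
    have hsum : ∑ i ∈ Q, s' i ≤ ∑ i ∈ P a, s i := by
      calc ∑ i ∈ Q, s' i ≤ ∑ i ∈ Q, s (f i) :=
            Finset.sum_le_sum fun i hi => hle i (hQJ i hi).1
        _ = ∑ i ∈ Q.image f, s i := (Finset.sum_image hio).symm
        _ ≤ ∑ i ∈ P a, s i := by
            refine Finset.sum_le_sum_of_subset_of_nonneg hsub ?_
            intro i hi _
            apply hs
            rw [← hu]
            exact Finset.mem_biUnion.mpr ⟨a, Finset.mem_univ _, hi⟩
    have hn : (Q.card - 1) / k ≤ ((P a).card - 1) / k :=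
      Nat.div_le_div_right (Nat.sub_le_sub_right hc 1)
    have hn' : (((Q.card - 1) / k : ℕ) : ℝ) ≤ ((((P a).card - 1) / k : ℕ) : ℝ) := by
      exact_mod_cast hn
    unfold binLoad
    exact add_le_add hsum (mul_le_mul_of_nonneg_right hn' hU.le)

theorem stmt13 {ι : Type*} [DecidableEq ι]
    (ε : ℝ) (E3 : ℕ) (hε : 0 < ε) (hε1 : ε ≤ 1) (hE3 : (E3 : ℝ) = 1 / ε ^ 3)
    (k : ℕ) (hk : 0 < k) (U : ℝ) (hU : 0 < U) (hU1 : U ≤ 1)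
    (J : Finset ι) (s : ι → ℝ) (hs : ∀ i ∈ J, 0 ≤ s i ∧ s i ≤ 1)
    -- the large items
    (L : Finset ι) (hL : L = J.filter fun i => ε ≤ s i)
    -- `q i` is the (1-based) index of the class of large item `i` in the linear
    -- grouping; the classes consist of consecutive large items in non-increasing
    -- order of size
    (q : ι → ℕ) (hq : ∀ i ∈ L, 1 ≤ q i ∧ q i ≤ E3)
    (hqord : ∀ i ∈ L, ∀ j ∈ L, q i < q j → s j ≤ s i)
    (hcard1 : (L.filter fun i => q i = 1).card = ⌈ε ^ 3 * L.card⌉₊)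
    (hcardE : (L.filter fun i => q i = E3).card = ⌊ε ^ 3 * L.card⌋₊)
    (hcardanti : ∀ c c' : ℕ, 1 ≤ c → c ≤ c' → c' ≤ E3 →
      (L.filter fun i => q i = c').card ≤ (L.filter fun i => q i = c).card)
    -- rounded sizes: small items are unchanged, and each large item of a class
    -- other than the first gets the largest size of its class
    (s' : ι → ℝ)
    (hs'small : ∀ i ∈ J, s i < ε → s' i = s i)
    (hs'large : ∀ i ∈ L, q i ≠ 1 →
      ∃ j ∈ L, q j = q i ∧ s' i = s j ∧ ∀ j' ∈ L, q j' = q i → s j' ≤ s j)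
    (N : ℕ) (hpack : HasPacking k U s J N) :
    HasPacking k U s' ((J.filter fun i => s i < ε) ∪ (L.filter fun i => q i ≠ 1)) N := by
  have hg : ∀ c : ℕ, ∃ g : ι → ι, 2 ≤ c → c ≤ E3 →
      (∀ x ∈ L.filter fun i => q i = c, g x ∈ L.filter fun i => q i = c - 1) ∧
      ∀ x ∈ L.filter fun i => q i = c, ∀ y ∈ L.filter fun i => q i = c,
        g x = g y → x = y := by
    intro c
    by_cases h : 2 ≤ c ∧ c ≤ E3
    · obtain ⟨g, hg⟩ := exists_inj_aux (L.filter fun i => q i = c) (L.filter fun i => q i = c - 1)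
        (hcardanti (c - 1) c (by omega) (by omega) h.2)
      exact ⟨g, fun _ _ => hg⟩
    · exact ⟨id, fun h1 h2 => absurd ⟨h1, h2⟩ h⟩
  choose g hg using hg
  have hg1 : ∀ x ∈ L, q x ≠ 1 → g (q x) x ∈ L ∧ q (g (q x) x) = q x - 1 := by
    intro x hx hx1
    have hh := hq x hx
    exact Finset.mem_filter.mp ((hg (q x) (by omega) hh.2).1 x (Finset.mem_filter.mpr ⟨hx, rfl⟩))
  have hLJ : ∀ x, x ∈ L ↔ x ∈ J ∧ ε ≤ s x := by
    intro x
    rw [hL, Finset.mem_filter]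
  have hmem : ∀ x ∈ (J.filter fun i => s i < ε) ∪ (L.filter fun i => q i ≠ 1),
      (x ∈ J ∧ s x < ε) ∨ (x ∈ L ∧ q x ≠ 1 ∧ ¬ s x < ε) := by
    intro x hx
    rcases Finset.mem_union.mp hx with h | h
    · exact Or.inl (Finset.mem_filter.mp h)
    · have h2 := Finset.mem_filter.mp h
      exact Or.inr ⟨h2.1, h2.2, not_lt.mpr ((hLJ x).mp h2.1).2⟩
  refine packing_aux k U hU J _ s s' (fun i hi => (hs i hi).1)
    (fun x => if s x < ε then x else g (q x) x) ?_ ?_ ?_ N hpack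
  · intro x hx
    rcases hmem x hx with ⟨h1, h2⟩ | ⟨h1, h2, h3⟩
    · simpa only [if_pos h2] using h1
    · simpa only [if_neg h3] using ((hLJ _).mp (hg1 x h1 h2).1).1
  · intro x hx y hy hxy
    rcases hmem x hx with ⟨h1, h2⟩ | ⟨h1, h2, h3⟩ <;>
    rcases hmem y hy with ⟨k1, k2⟩ | ⟨k1, k2, k3⟩
    · simpa only [if_pos h2, if_pos k2] using hxy
    · simp only [if_pos h2, if_neg k3] at hxy
      have := ((hLJ _).mp (hg1 y k1 k2).1).2
      rw [← hxy] at this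
      linarith
    · simp only [if_neg h3, if_pos k2] at hxy
      have := ((hLJ _).mp (hg1 x h1 h2).1).2
      rw [hxy] at this
      linarith
    · simp only [if_neg h3, if_neg k3] at hxy
      have e1 := (hg1 x h1 h2).2
      have e2 := (hg1 y k1 k2).2
      rw [hxy] at e1
      have b1 := hq x h1
      have b2 := hq y k1
      have e : q y = q x := by omega
      rw [e] at hxy
      exact (hg (q x) (by omega) b1.2).2 x (Finset.mem_filter.mpr ⟨h1, rfl⟩) y
        (Finset.mem_filter.mpr ⟨k1, e⟩) hxy
  · intro x hx
    rcases hmem x hx with ⟨h1, h2⟩ | ⟨h1, h2, h3⟩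
    · simp only [if_pos h2]
      exact (hs'small x h1 h2).le
    · simp only [if_neg h3]
      obtain ⟨j, hj, hqj, hsj, _⟩ := hs'large x h1 h2
      rw [hsj]
      have e1 := hg1 x h1 h2
      have b1 := hq x h1
      exact hqord _ e1.1 j hj (by omega)
end

section
/- Let ε ∈ (0,1] with 1/ε a positive integer, let k be a positive integer, and let U ∈ (0,1]. If the item set admits a feasible packing into N bins (each of load at most 1), then it admits a partition into at most (1+ε)·N + 1 bins each of which is reformulated-feasible. -/
open Finset

/-- `Ep` and `Lp` are the early and late items of the bin `b`: they partition `b`,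
the early items are the first `min(|b|, k·E)` items in non-increasing order of size
(with `E = 1/ε`), and the late items are the rest. -/
def EarlySplit {ι : Type*} [DecidableEq ι] (k E : ℕ) (s : ι → ℝ)
    (b Ep Lp : Finset ι) : Prop :=
  Disjoint Ep Lp ∧ Ep ∪ Lp = b ∧ Ep.card = min b.card (k * E) ∧
  ∀ i ∈ Ep, ∀ j ∈ Lp, s j ≤ s i

/-- The reformulated load of a bin with early items `Ep` and late items `Lp`:
if there are no late items it is the usual BPU load, and otherwise each late item
gets modified size `s i + U/k` and exactly `E = 1/ε` idle items are counted. -/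
noncomputable def rLoadEL {ι : Type*} (k E : ℕ) (U : ℝ) (s : ι → ℝ)
    (Ep Lp : Finset ι) : ℝ :=
  if Lp.Nonempty then (∑ i ∈ Ep, s i) + (∑ i ∈ Lp, (s i + U / k)) + (E : ℝ) * U
  else binLoad k U s Ep

/-- A bin is reformulated-feasible if its reformulated load is at most `1`. -/
def RFeasibleBin {ι : Type*} [DecidableEq ι] (k E : ℕ) (U : ℝ) (s : ι → ℝ)
    (b : Finset ι) : Prop :=
  ∃ Ep Lp : Finset ι, EarlySplit k E s b Ep Lp ∧ rLoadEL k E U s Ep Lp ≤ 1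

/-- A partition of the items of `J` into at most `N` reformulated-feasible bins. -/
def HasRPacking {ι : Type*} [DecidableEq ι] (k E : ℕ) (U : ℝ) (s : ι → ℝ)
    (J : Finset ι) (N : ℕ) : Prop :=
  ∃ P : Fin N → Finset ι,
    (∀ a b : Fin N, a ≠ b → Disjoint (P a) (P b)) ∧
    Finset.univ.biUnion P = J ∧
    ∀ a, RFeasibleBin k E U s (P a)

theorem exists_smallest {ι : Type*} [DecidableEq ι] (s : ι → ℝ) (b : Finset ι) (m : ℕ)
    (hm : m ≤ b.card) : ∃ R ⊆ b, R.card = m ∧ ∀ i ∈ b \ R, ∀ j ∈ R, s j ≤ s i := by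
  induction m with
  | zero => exact ⟨∅, by simp, by simp, by simp⟩
  | succ m ih =>
    obtain ⟨R, hR, hc, h⟩ := ih (by omega)
    have hne : (b \ R).Nonempty := by
      rw [← Finset.card_pos, Finset.card_sdiff_of_subset hR]; omega
    obtain ⟨x, hx, hmin⟩ := Finset.exists_min_image (b \ R) s hne
    have hx' := Finset.mem_sdiff.1 hx
    refine ⟨insert x R, ?_, ?_, ?_⟩
    · intro y hy
      rcases Finset.mem_insert.1 hy with rfl | hy
      · exact hx'.1
      · exact hR hy
    · rw [Finset.card_insert_of_notMem hx'.2, hc]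
    · intro i hi j hj
      have hi' : i ∈ b \ R := by
        simp only [Finset.mem_sdiff, Finset.mem_insert, not_or] at hi ⊢
        exact ⟨hi.1, hi.2.2⟩
      rcases Finset.mem_insert.1 hj with rfl | hj
      · exact hmin i hi'
      · exact h i hi' j hj

theorem rfeas_small {ι : Type*} [DecidableEq ι] (k E : ℕ) (U : ℝ) (s : ι → ℝ) (b : Finset ι)
    (hc : b.card ≤ k * E) (hl : binLoad k U s b ≤ 1) : RFeasibleBin k E U s b :=
  ⟨b, ∅, ⟨by simp, by simp, by simp [hc], by simp⟩, by simpa [rLoadEL] using hl⟩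

theorem rfeas_large {ι : Type*} [DecidableEq ι] (k E : ℕ) (hk : 0 < k) (U : ℝ) (s : ι → ℝ)
    (b : Finset ι) (hc : k * E < b.card)
    (hl : (∑ i ∈ b, s i) + (b.card : ℝ) / k * U ≤ 1) : RFeasibleBin k E U s b := by
  obtain ⟨R, hR, hRc, h⟩ := exists_smallest s b (b.card - k * E) (by omega)
  refine ⟨b \ R, R, ⟨Finset.sdiff_disjoint, Finset.sdiff_union_of_subset hR, ?_, h⟩, ?_⟩
  · rw [Finset.card_sdiff_of_subset hR, hRc, min_eq_right hc.le]; omega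
  · have hne : R.Nonempty := by rw [← Finset.card_pos]; omega
    rw [rLoadEL, if_pos hne, Finset.sum_add_distrib, Finset.sum_const, hRc, nsmul_eq_mul,
      Nat.cast_sub hc.le]
    have h1 := Finset.sum_sdiff (f := s) hR
    have hk' : (k : ℝ) ≠ 0 := by positivity
    have : ((b.card : ℝ) - ((k * E : ℕ) : ℝ)) * (U / k) + E * U = (b.card : ℝ) / k * U := by
      push_cast; field_simp; ring
    linarith

theorem split_bin {ι : Type*} [DecidableEq ι] (k E : ℕ) (hk : 0 < k) (hE : 0 < E) (U : ℝ)
    (hU : 0 < U) (s : ι → ℝ) (b : Finset ι) (hs : ∀ i ∈ b, 0 ≤ s i)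
    (hl : binLoad k U s b ≤ 1) :
    ∃ R ⊆ b, R.card ≤ k ∧ RFeasibleBin k E U s (b \ R) ∧
      (R = ∅ ∨ 0 ≤ 1 - E * U ∧ E * ∑ i ∈ R, s i ≤ 1 - E * U) := by
  by_cases hc : b.card ≤ k * E
  · exact ⟨∅, by simp, by simp, by simpa using rfeas_small k E U s b hc hl, Or.inl rfl⟩
  push Not at hc
  have hkE : k ≤ k * E := Nat.le_mul_of_pos_right k hE
  obtain ⟨R, hR, hRc, h⟩ := exists_smallest s b k (by omega)
  have hsum := Finset.sum_sdiff (f := s) hR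
  have hcs : (b \ R).card = b.card - k := by rw [Finset.card_sdiff_of_subset hR, hRc]
  have hR0 : 0 ≤ ∑ i ∈ R, s i := Finset.sum_nonneg fun i hi => hs i (hR hi)
  have hk0 : (0 : ℝ) < k := by positivity
  unfold binLoad at hl
  have hb0 : 0 ≤ ∑ i ∈ b, s i := Finset.sum_nonneg hs
  refine ⟨R, hR, hRc.le, ?_, Or.inr ?_⟩
  · by_cases hc2 : (b \ R).card ≤ k * E
    · apply rfeas_small _ _ _ _ _ hc2
      unfold binLoad
      have : (((b \ R).card - 1) / k : ℕ) ≤ (b.card - 1) / k := Nat.div_le_div_right (by omega)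
      have : ((((b \ R).card - 1) / k : ℕ) : ℝ) * U ≤ (((b.card - 1) / k : ℕ) : ℝ) * U := by
        gcongr
      linarith
    · push Not at hc2
      apply rfeas_large _ _ hk _ _ _ hc2
      have h1 : b.card - k ≤ (b.card - 1) / k * k := by
        have := Nat.div_add_mod (b.card - 1) k
        have := Nat.mod_lt (b.card - 1) hk
        rw [mul_comm]; omega
      have h2 : ((b \ R).card : ℝ) / k ≤ (((b.card - 1) / k : ℕ) : ℝ) := by
        rw [div_le_iff₀ hk0, hcs]; exact_mod_cast h1
      have := mul_le_mul_of_nonneg_right h2 hU.le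
      linarith
  · have h1 : E ≤ (b.card - 1) / k := by
      rw [Nat.le_div_iff_mul_le hk, mul_comm]; omega
    have h2 : (E : ℝ) * U ≤ (((b.card - 1) / k : ℕ) : ℝ) * U := by gcongr
    refine ⟨by linarith, ?_⟩
    have h3 : ((b \ R).card : ℝ) * ∑ j ∈ R, s j ≤ k * ∑ i ∈ b \ R, s i := by
      calc _ = ∑ i ∈ b \ R, ∑ j ∈ R, s j := by simp
        _ ≤ ∑ i ∈ b \ R, ∑ j ∈ R, s i :=
          Finset.sum_le_sum fun i hi => Finset.sum_le_sum fun j hj => h i hi j hj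
        _ = _ := by simp [hRc, Finset.mul_sum]
    have h4 : (k : ℝ) * E ≤ (b \ R).card + k := by
      have : k * E ≤ (b \ R).card + k := by omega
      exact_mod_cast this
    have h5 := mul_le_mul_of_nonneg_right h4 hR0
    have h6 : (k : ℝ) * (E * ∑ i ∈ R, s i) ≤ k * ∑ i ∈ b, s i := by
      rw [← hsum]; linarith
    have := le_of_mul_le_mul_left h6 hk0
    linarith

theorem stmt17 {ι : Type*} [DecidableEq ι] (ε : ℝ) (E : ℕ) (hε : 0 < ε) (hε1 : ε ≤ 1)
    (hE : (E : ℝ) = 1 / ε) (k : ℕ) (hk : 0 < k) (U : ℝ) (hU : 0 < U) (hU1 : U ≤ 1)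
    (J : Finset ι) (s : ι → ℝ) (hs : ∀ i ∈ J, 0 ≤ s i ∧ s i ≤ 1)
    (N : ℕ) (hpack : HasPacking k U s J N) :
    ∃ M : ℕ, (M : ℝ) ≤ (1 + ε) * N + 1 ∧ HasRPacking k E U s J M := by
  obtain ⟨P, hdisj, hun, hload⟩ := hpack
  have hE0 : 0 < E := by
    have : (0 : ℝ) < E := by rw [hE]; positivity
    exact_mod_cast this
  have hER : (0 : ℝ) < E := by exact_mod_cast hE0
  have hPJ : ∀ a, P a ⊆ J := fun a => hun ▸ Finset.subset_biUnion_of_mem P (Finset.mem_univ a)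
  choose R hRP hRc hRf hRs using fun a =>
    split_bin k E hk hE0 U hU s (P a) (fun i hi => (hs i (hPJ a hi)).1) (hload a)
  have hRdisj : ∀ a b, a ≠ b → Disjoint (R a) (R b) := fun a b hab =>
    Finset.disjoint_of_subset_left (hRP a) (Finset.disjoint_of_subset_right (hRP b) (hdisj a b hab))
  let F : Fin (N / E + 1) → Finset (Fin N) := fun j => Finset.univ.filter fun a => a.val / E = j.val
  let Q : Fin (N / E + 1) → Finset ι := fun j => (F j).biUnion R
  have hFc : ∀ j, (F j).card ≤ E := by
    intro j
    have : (F j).card ≤ (Finset.range E).card := by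
      apply Finset.card_le_card_of_injOn (fun a => a.val % E)
      · intro a _; simpa using Nat.mod_lt _ hE0
      · intro a ha b hb hab
        have ha' : a.val / E = j.val := by simpa [F] using ha
        have hb' : b.val / E = j.val := by simpa [F] using hb
        have h1 := Nat.div_add_mod a.val E
        have h2 := Nat.div_add_mod b.val E
        simp only at hab
        rw [ha', hab] at h1
        rw [hb'] at h2
        exact Fin.ext (h1.symm.trans h2)
    simpa using this
  refine ⟨N + (N / E + 1), ?_, Fin.append (fun a => P a \ R a) Q, ?_, ?_, ?_⟩
  · have h1 : ((N / E : ℕ) : ℝ) ≤ N / E := Nat.cast_div_le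
    rw [hE] at h1
    have : (N : ℝ) / (1 / ε) = ε * N := by field_simp
    push_cast
    linarith
  · have key : ∀ a j, Disjoint (P a \ R a) (Q j) := by
      intro a j
      rw [Finset.disjoint_biUnion_right]
      intro b _
      by_cases hab : a = b
      · subst hab; exact Finset.sdiff_disjoint
      · exact Finset.disjoint_of_subset_left Finset.sdiff_subset
          (Finset.disjoint_of_subset_right (hRP b) (hdisj a b hab))
    intro a b
    refine Fin.addCases (fun a => ?_) (fun a => ?_) a <;>
      refine Fin.addCases (fun b => ?_) (fun b => ?_) b <;> intro hab <;>
      simp only [Fin.append_left, Fin.append_right]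
    · exact Finset.disjoint_of_subset_left Finset.sdiff_subset
        (Finset.disjoint_of_subset_right Finset.sdiff_subset
          (hdisj a b fun h => hab (by rw [h])))
    · exact key a b
    · exact (key b a).symm
    · simp only [Q]
      rw [Finset.disjoint_biUnion_left]
      intro x hx
      rw [Finset.disjoint_biUnion_right]
      intro y hy
      apply hRdisj
      rintro rfl
      simp only [F, Finset.mem_filter] at hx hy
      exact hab (by rw [Fin.ext (hx.2.symm.trans hy.2)])
  · ext x
    rw [← hun]
    simp only [Finset.mem_biUnion, Finset.mem_univ, true_and]
    constructor
    · rintro ⟨a, ha⟩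
      revert ha
      refine Fin.addCases (fun a => ?_) (fun a => ?_) a <;>
        simp only [Fin.append_left, Fin.append_right] <;> intro ha
      · exact ⟨a, (Finset.mem_sdiff.1 ha).1⟩
      · obtain ⟨b, _, hb⟩ := Finset.mem_biUnion.1 ha
        exact ⟨b, hRP b hb⟩
    · rintro ⟨a, ha⟩
      by_cases hx : x ∈ R a
      · refine ⟨Fin.natAdd N ⟨a.val / E, Nat.lt_succ_of_le (Nat.div_le_div_right a.2.le)⟩, ?_⟩
        simp only [Fin.append_right]
        exact Finset.mem_biUnion.2 ⟨a, by simp [F], hx⟩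
      · refine ⟨Fin.castAdd _ a, ?_⟩
        simp only [Fin.append_left]
        exact Finset.mem_sdiff.2 ⟨ha, hx⟩
  · intro a
    refine Fin.addCases (fun a => ?_) (fun j => ?_) a <;>
      simp only [Fin.append_left, Fin.append_right]
    · exact hRf a
    · have hQc : (Q j).card ≤ k * E := by
        calc (Q j).card ≤ (F j).card * k := Finset.card_biUnion_le_card_mul _ _ _ fun a _ => hRc a
          _ ≤ E * k := Nat.mul_le_mul_right _ (hFc j)
          _ = k * E := mul_comm _ _
      apply rfeas_small _ _ _ _ _ hQc
      unfold binLoad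
      rcases (Q j).eq_empty_or_nonempty with h0 | ⟨x, hx⟩
      · simp [h0]
      obtain ⟨a, _, hxa⟩ := Finset.mem_biUnion.1 hx
      have hpos : 0 ≤ 1 - E * U := by
        rcases hRs a with h | h
        · simp [h] at hxa
        · exact h.1
      have hb : ∀ a, ∑ i ∈ R a, s i ≤ (1 - E * U) / E := by
        intro a
        rw [le_div_iff₀ hER, mul_comm]
        rcases hRs a with h | h
        · simpa [h] using hpos
        · exact h.2
      have hsumQ : ∑ i ∈ Q j, s i ≤ 1 - E * U := by
        simp only [Q]
        rw [Finset.sum_biUnion fun a _ b _ hab => hRdisj a b hab]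
        calc _ ≤ (F j).card • ((1 - E * U) / E) := Finset.sum_le_card_nsmul _ _ _ fun a _ => hb a
          _ ≤ E * ((1 - E * U) / E) := by
            rw [nsmul_eq_mul]
            exact mul_le_mul_of_nonneg_right (by exact_mod_cast hFc j) (by positivity)
          _ = _ := by field_simp
      have h1 : ((Q j).card - 1) / k ≤ E := Nat.div_le_of_le_mul (by omega)
      have h2 : ((((Q j).card - 1) / k : ℕ) : ℝ) * U ≤ E * U := by gcongr
      linarith
end

section
/- Fix ε ∈ (0,1] with 1/ε a positive integer, a positive integer k, and U ∈ (0,1]. Let the item set consist of large items whose sizes lie in a finite set Z with z ≥ ε for every z ∈ Z (with n(z) items of size z) and small items Sma, each of size less than ε. If the item set admits a partition into N reformulated-feasible bins, then there exist u : C → ℕ (C the set of feasible configurations) and v, w : Sma × {0,1,…,1/ε} → {0,1} such that: Σ_{c∈C} u_c ≤ N; Σ_{c∈C} u_c·α_{cz} ≥ n(z) for every z ∈ Z; Σ_{η=0}^{1/ε} (v_{iη} + w_{iη}) ≥ 1 for every i ∈ Sma; for every η ∈ {0,…,1/ε}: Σ_{i∈Sma} v_{iη}·s_i ≤ Σ_{c∈C: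 γ_c=η} u_c·(1 − (Σ_{z∈Z} z·α_{cz} + γ'_c·γ_c·ε + (δ_c − 1 + γ'_c)·U)); Σ_{i∈Sma} w_{iη}·ŝ_i ≤ Σ_{c∈C: γ_c=η} u_c·γ'_c·(γ_c + 1)·ε; and Σ_{c∈C: γ_c=η} u_c·Σ_{z∈Z} α_{cz} + Σ_{i∈Sma} v_{iη} ≤ Σ_{c∈C: γ_c=η} u_c·δ_c·k. -/
open Finset

/-- A configuration for the bin packing problem BPU (case II): counts of large items
of each distinct size in `Z`, the rounded-up number `δ` of `k`-blocks of early items,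
the rounded total modified size `γ` of late items, and a bit `γ'` indicating the
presence of late items (`γ = 0` whenever `γ' = 0`), with `1 ≤ δ ≤ E` and
`0 ≤ γ ≤ E`, where `E = 1/ε`. -/
structure BConfig2 (Z : Finset ℝ) (E : ℕ) where
  alpha : {z // z ∈ Z} → ℕ
  delta : ℕ
  gamma : ℕ
  gammaP : ℕ
  one_le_delta : 1 ≤ delta
  delta_le : delta ≤ E
  gamma_le : gamma ≤ E
  gammaP_le_one : gammaP ≤ 1
  gamma_of_gammaP : gammaP = 0 → gamma = 0

/-- The load of a configuration; the configuration is feasible if its load is at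
most `1`. -/
noncomputable def bConfigLoad (ε U : ℝ) {Z : Finset ℝ} {E : ℕ} (c : BConfig2 Z E) : ℝ :=
  (∑ z ∈ Z.attach, (z : ℝ) * (c.alpha z : ℝ)) + (c.gammaP : ℝ) * (c.gamma : ℝ) * ε +
    ((c.delta : ℝ) - 1 + (c.gammaP : ℝ)) * U

lemma aux_fiber {ι : Type*} (ε : ℝ) (Z : Finset ℝ) (hZ : ∀ z ∈ Z, ε ≤ z)
    (A : Finset ι) (s : ι → ℝ) (hl : ∀ i ∈ A, ε ≤ s i → s i ∈ Z) (f : ℝ → ℝ) :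
    ∑ z ∈ Z.attach, f (z : ℝ) * ((A.filter fun i => s i = (z : ℝ)).card : ℝ) =
      ∑ i ∈ A.filter (fun i => ¬ s i < ε), f (s i) := by
  rw [Finset.sum_attach Z (fun z => f z * ((A.filter fun i => s i = z).card : ℝ))]
  rw [← Finset.sum_fiberwise_of_maps_to (s := A.filter (fun i => ¬ s i < ε)) (t := Z) (g := s)
    (fun i hi => by
      rw [Finset.mem_filter] at hi
      exact hl i hi.1 (not_lt.1 hi.2))]
  refine Finset.sum_congr rfl fun z hz => ?_
  have h1 : (A.filter (fun i => ¬ s i < ε)).filter (fun i => s i = z) =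
      A.filter (fun i => s i = z) := by
    ext i
    simp only [Finset.mem_filter]
    constructor
    · rintro ⟨⟨h, _⟩, h'⟩
      exact ⟨h, h'⟩
    · rintro ⟨h, h'⟩
      refine ⟨⟨h, ?_⟩, h'⟩
      rw [h']
      exact not_lt.2 (hZ z hz)
  rw [h1, Finset.sum_congr rfl (fun i hi => by rw [(Finset.mem_filter.1 hi).2] :
    ∀ i ∈ A.filter (fun i => s i = z), f (s i) = f z)]
  rw [Finset.sum_const, nsmul_eq_mul, mul_comm]

lemma aux_bin {ι : Type*} [DecidableEq ι] (ε : ℝ) (E : ℕ) (hε : 0 < ε)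
    (hE : (E : ℝ) = 1 / ε) (k : ℕ) (hk : 0 < k) (U : ℝ) (hU : 0 < U)
    (Z : Finset ℝ) (hZ : ∀ z ∈ Z, ε ≤ z)
    (b : Finset ι) (s : ι → ℝ) (hs : ∀ i ∈ b, 0 ≤ s i)
    (hlarge : ∀ i ∈ b, ε ≤ s i → s i ∈ Z) (hb : RFeasibleBin k E U s b) :
    ∃ (c : BConfig2 Z E) (Ep Lp : Finset ι), Ep ∪ Lp = b ∧
      (∀ z : {z // z ∈ Z}, (b.filter fun i => s i = (z : ℝ)).card = c.alpha z) ∧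
      (∑ i ∈ Ep.filter (fun i => s i < ε), s i) ≤ 1 - bConfigLoad ε U c ∧
      (∑ i ∈ Lp.filter (fun i => s i < ε), (s i + U / k)) ≤
        (c.gammaP : ℝ) * ((c.gamma : ℝ) + 1) * ε ∧
      (∑ z ∈ Z.attach, (c.alpha z : ℝ)) + ∑ i ∈ Ep.filter (fun i => s i < ε), (1 : ℝ) ≤
        (c.delta : ℝ) * k := by
  obtain ⟨Ep, Lp, ⟨hd, hun, hcard, hord⟩, hload⟩ := hb
  have hEε : (E : ℝ) * ε = 1 := by rw [hE]; field_simp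
  have hE1 : 1 ≤ E := by
    rcases Nat.eq_zero_or_pos E with h | h
    · subst h; simp at hEε
    · exact h
  have hk' : (0 : ℝ) < k := by exact_mod_cast hk
  have hk1 : (1 : ℝ) ≤ k := by exact_mod_cast hk
  have hUk : 0 < U / k := by positivity
  have hEpb : Ep ⊆ b := hun ▸ Finset.subset_union_left
  have hLpb : Lp ⊆ b := hun ▸ Finset.subset_union_right
  have hsE : 0 ≤ ∑ i ∈ Ep, s i := Finset.sum_nonneg fun i hi => hs i (hEpb hi)
  have hsL : 0 ≤ ∑ i ∈ Lp, (s i + U / k) :=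
    Finset.sum_nonneg fun i hi => add_nonneg (hs i (hLpb hi)) hUk.le
  have hEU : 0 < (E : ℝ) * U := by
    have : (1 : ℝ) ≤ E := by exact_mod_cast hE1
    positivity
  have hLcard : Lp.Nonempty → Ep.card = k * E := by
    intro h
    have h1 : b.card = Ep.card + Lp.card := by rw [← hun, Finset.card_union_of_disjoint hd]
    have h2 := h.card_pos
    omega
  have hlate : ∀ j ∈ Lp, s j < ε := by
    intro j hj
    by_contra hc
    push Not at hc
    have hne : Lp.Nonempty := ⟨j, hj⟩
    rw [rLoadEL, if_pos hne] at hload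
    have h1 : (Ep.card : ℝ) * ε ≤ ∑ i ∈ Ep, s i := by
      rw [← nsmul_eq_mul]
      exact Finset.card_nsmul_le_sum _ _ _ fun i hi => hc.trans (hord i hi j hj)
    rw [hLcard hne] at h1
    push_cast at h1
    have h2 : (k : ℝ) * E * ε = k := by rw [mul_assoc, hEε, mul_one]
    linarith
  have hEcard : Ep.card ≤ k * E := by omega
  have hEl : ∀ i ∈ Ep, ε ≤ s i → s i ∈ Z := fun i hi => hlarge i (hEpb hi)
  have hal : ∀ z : {z // z ∈ Z}, b.filter (fun i => s i = (z : ℝ)) =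
      Ep.filter (fun i => s i = (z : ℝ)) := by
    intro z
    rw [← hun, Finset.filter_union, Finset.filter_false_of_mem (s := Lp), Finset.union_empty]
    intro i hi h
    have := hlate i hi
    have := hZ z z.2
    linarith
  have f1 := aux_fiber ε Z hZ Ep s hEl (fun x => x)
  have f2 := aux_fiber ε Z hZ Ep s hEl (fun _ => 1)
  have g1 := Finset.sum_filter_add_sum_filter_not Ep (fun i => s i < ε) s
  have g2 := Finset.sum_filter_add_sum_filter_not Ep (fun i => s i < ε) (fun _ => (1 : ℝ))
  simp only [one_mul] at f2
  have g3 : ∑ i ∈ Ep, (1 : ℝ) = Ep.card := by simp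
  have hδ : (Ep.card - 1) / k + 1 ≤ E := by
    have : (Ep.card - 1) / k < E := by
      rw [Nat.div_lt_iff_lt_mul hk]
      have : 0 < k * E := Nat.mul_pos hk hE1
      rw [mul_comm E k]
      omega
    omega
  have hcδ : (Ep.card : ℝ) ≤ (((Ep.card - 1) / k + 1 : ℕ) : ℝ) * k := by
    have h := Nat.lt_div_mul_add hk (a := Ep.card - 1)
    have h' : Ep.card ≤ ((Ep.card - 1) / k + 1) * k := by
      rw [add_mul, one_mul]; omega
    exact_mod_cast h'
  by_cases hne : Lp.Nonempty
  · rw [rLoadEL, if_pos hne] at hload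
    set S := ∑ i ∈ Lp, (s i + U / k) with hS
    have hfl : (⌊S / ε⌋₊ : ℝ) * ε ≤ S := by
      rw [← le_div_iff₀ hε]
      exact Nat.floor_le (by positivity)
    have hfl2 : S ≤ ((⌊S / ε⌋₊ : ℝ) + 1) * ε := by
      rw [← div_le_iff₀ hε]
      exact (Nat.lt_floor_add_one _).le
    have hγ : ⌊S / ε⌋₊ ≤ E := by
      have : (⌊S / ε⌋₊ : ℝ) * ε ≤ E * ε := by linarith
      have := le_of_mul_le_mul_right this hε
      exact_mod_cast this
    refine ⟨⟨fun z => (Ep.filter fun i => s i = (z : ℝ)).card, E, ⌊S / ε⌋₊, 1, hE1, le_rfl, hγ,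
      le_rfl, by simp⟩, Ep, Lp, hun, fun z => by rw [hal], ?_, ?_, ?_⟩
    · simp only [bConfigLoad]
      push_cast
      linarith
    · rw [Finset.filter_true_of_mem hlate]
      push_cast
      linarith
    · simp only
      have : (Ep.card : ℝ) = k * E := by exact_mod_cast hLcard hne
      linarith
  · rw [rLoadEL, if_neg hne, binLoad] at hload
    refine ⟨⟨fun z => (Ep.filter fun i => s i = (z : ℝ)).card, (Ep.card - 1) / k + 1, 0, 0,
      Nat.le_add_left 1 _, hδ, Nat.zero_le _, Nat.zero_le _, fun _ => rfl⟩, Ep, Lp, hun, fun z => by rw [hal], ?_, ?_, ?_⟩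
    · simp only [bConfigLoad]
      push_cast at hload ⊢
      linarith
    · rw [Finset.not_nonempty_iff_eq_empty.1 hne]
      simp
    · simp only
      linarith

lemma aux_count {C : Type*} [DecidableEq C] {N : ℕ} (c : Fin N → C) (p : C → Prop)
    [DecidablePred p] (g : C → ℝ) :
    ∑ x ∈ (Finset.univ.image c).filter p,
      (((Finset.univ.filter fun a => c a = x).card : ℕ) : ℝ) * g x =
    ∑ a ∈ Finset.univ.filter (fun a => p (c a)), g (c a) := by
  rw [← Finset.sum_fiberwise_of_maps_to (s := Finset.univ.filter (fun a => p (c a)))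
    (t := (Finset.univ.image c).filter p) (g := c) (fun a ha => by simpa using ha)]
  refine Finset.sum_congr rfl fun x hx => ?_
  have hx := (Finset.mem_filter.1 hx).2
  have h1 : (Finset.univ.filter (fun a => p (c a))).filter (fun a => c a = x) =
      Finset.univ.filter (fun a => c a = x) := by
    ext a
    simp only [Finset.mem_filter, Finset.mem_univ, true_and]
    constructor
    · exact fun h => h.2
    · intro h
      exact ⟨h ▸ hx, h⟩
  rw [h1, Finset.sum_congr rfl (fun i hi => by rw [(Finset.mem_filter.1 hi).2] :
    ∀ i ∈ Finset.univ.filter (fun a => c a = x), g (c i) = g x)]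
  rw [Finset.sum_const, nsmul_eq_mul]

lemma aux_ind {ι : Type*} [DecidableEq ι] {N : ℕ} (A : Fin N → Finset ι) (J : Finset ι)
    (hA : ∀ a, A a ⊆ J) (t : ι → Prop) [DecidablePred t]
    (p : Fin N → Prop) [DecidablePred p] (f : ι → ℝ) (hf : ∀ i ∈ J, 0 ≤ f i) (v : ι → ℝ)
    (hv1 : ∀ i, (∃ a, i ∈ A a ∧ p a) → v i = 1) (hv0 : ∀ i, (¬ ∃ a, i ∈ A a ∧ p a) → v i = 0) :
    ∑ i ∈ J.filter t, v i * f i ≤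
      ∑ a ∈ Finset.univ.filter p, ∑ i ∈ (A a).filter t, f i := by
  have h1 : ∀ a, ∑ i ∈ (A a).filter t, f i =
      ∑ i ∈ J.filter t, (if i ∈ A a then (1 : ℝ) else 0) * f i := by
    intro a
    simp only [ite_mul, one_mul, zero_mul]
    rw [← Finset.sum_filter]
    refine Finset.sum_congr ?_ fun _ _ => rfl
    ext i
    simp only [Finset.mem_filter]
    constructor
    · exact fun h => ⟨⟨hA a h.1, h.2⟩, h.1⟩
    · exact fun h => ⟨h.2, h.1.2⟩
  simp only [h1]
  rw [Finset.sum_comm]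
  refine Finset.sum_le_sum fun i hi => ?_
  have hfi := hf i (Finset.mem_filter.1 hi).1
  rw [← Finset.sum_mul]
  refine mul_le_mul_of_nonneg_right ?_ hfi
  by_cases h : ∃ a, i ∈ A a ∧ p a
  · rw [hv1 i h]
    obtain ⟨a, ha, hp⟩ := h
    have := Finset.single_le_sum (s := Finset.univ.filter p)
      (f := fun a => if i ∈ A a then (1 : ℝ) else 0)
      (fun a _ => by split_ifs <;> norm_num) (a := a) (by simpa using hp)
    simpa [ha] using this
  · rw [hv0 i h]
    exact Finset.sum_nonneg fun a _ => by split_ifs <;> norm_num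

theorem stmt18 {ι : Type*} [DecidableEq ι] (ε : ℝ) (E : ℕ) (hε : 0 < ε) (hε1 : ε ≤ 1)
    (hE : (E : ℝ) = 1 / ε) (k : ℕ) (hk : 0 < k) (U : ℝ) (hU : 0 < U) (hU1 : U ≤ 1)
    (Z : Finset ℝ) (hZ : ∀ z ∈ Z, ε ≤ z)
    (J : Finset ι) (s : ι → ℝ) (hs : ∀ i ∈ J, 0 ≤ s i ∧ s i ≤ 1)
    (hlarge : ∀ i ∈ J, ε ≤ s i → s i ∈ Z)
    (Sma : Finset ι) (hSma : Sma = J.filter fun i => s i < ε)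
    (N : ℕ) (hpack : HasRPacking k E U s J N) :
    ∃ (F : Finset (BConfig2 Z E)) (u : BConfig2 Z E → ℕ) (v w : ι → ℕ → ℝ),
      (∀ c ∈ F, bConfigLoad ε U c ≤ 1) ∧
      (∑ c ∈ F, u c) ≤ N ∧
      (∀ z : {z // z ∈ Z},
        (J.filter fun i => s i = (z : ℝ)).card ≤ ∑ c ∈ F, u c * c.alpha z) ∧
      (∀ i ∈ Sma, ∀ η, (v i η = 0 ∨ v i η = 1) ∧ (w i η = 0 ∨ w i η = 1)) ∧
      (∀ i ∈ Sma, 1 ≤ ∑ η ∈ Finset.range (E + 1), (v i η + w i η)) ∧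
      (∀ η ∈ Finset.range (E + 1),
        (∑ i ∈ Sma, v i η * s i) ≤
          ∑ c ∈ F.filter (fun c => c.gamma = η), (u c : ℝ) * (1 - bConfigLoad ε U c)) ∧
      (∀ η ∈ Finset.range (E + 1),
        (∑ i ∈ Sma, w i η * (s i + U / k)) ≤
          ∑ c ∈ F.filter (fun c => c.gamma = η),
            (u c : ℝ) * (c.gammaP : ℝ) * ((c.gamma : ℝ) + 1) * ε) ∧
      (∀ η ∈ Finset.range (E + 1),
        (∑ c ∈ F.filter (fun c => c.gamma = η),
            (u c : ℝ) * (∑ z ∈ Z.attach, (c.alpha z : ℝ))) + (∑ i ∈ Sma, v i η) ≤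
          ∑ c ∈ F.filter (fun c => c.gamma = η), (u c : ℝ) * (c.delta : ℝ) * k) := by
  classical
  obtain ⟨P, -, hPJ, hP⟩ := hpack
  have hPs : ∀ a, P a ⊆ J := fun a => by
    rw [← hPJ]; exact Finset.subset_biUnion_of_mem P (Finset.mem_univ a)
  have key := fun a => aux_bin ε E hε hE k hk U hU Z hZ (P a) s (fun i hi => (hs i (hPs a hi)).1)
    (fun i hi => hlarge i (hPs a hi)) (hP a)
  choose c Ep Lp hun hal h1 h2 h3 using key
  have hEp : ∀ a, Ep a ⊆ J := fun a =>
    (Finset.subset_union_left.trans (hun a).subset).trans (hPs a)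
  have hLp : ∀ a, Lp a ⊆ J := fun a =>
    (Finset.subset_union_right.trans (hun a).subset).trans (hPs a)
  have hUk : 0 ≤ U / k := by positivity
  have hcard : ∀ (g : BConfig2 Z E → ℕ), ∑ x ∈ Finset.univ.image c,
      (Finset.univ.filter fun a => c a = x).card * g x = ∑ a, g (c a) := by
    intro g
    have := aux_count c (fun _ => True) (fun x => (g x : ℝ))
    simp only [Finset.filter_true] at this
    exact_mod_cast this
  subst hSma
  have hex : ∀ A : Fin N → Finset ι, ∃ v : ι → ℕ → ℝ,
      (∀ η i, (∃ a, i ∈ A a ∧ (c a).gamma = η) → v i η = 1) ∧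
      (∀ η i, (¬ ∃ a, i ∈ A a ∧ (c a).gamma = η) → v i η = 0) := fun A =>
    ⟨fun i η => if ∃ a, i ∈ A a ∧ (c a).gamma = η then 1 else 0,
      fun η i h => if_pos h, fun η i h => if_neg h⟩
  have hnn : ∀ x : ℝ, x = 0 ∨ x = 1 → 0 ≤ x := by
    rintro x (rfl | rfl) <;> norm_num
  obtain ⟨v, hv1, hv0⟩ := hex Ep
  obtain ⟨w, hw1, hw0⟩ := hex Lp
  have hv : ∀ i η, v i η = 0 ∨ v i η = 1 := fun i η =>
    (Classical.em _).elim (fun h => Or.inr (hv1 η i h)) (fun h => Or.inl (hv0 η i h))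
  have hw : ∀ i η, w i η = 0 ∨ w i η = 1 := fun i η =>
    (Classical.em _).elim (fun h => Or.inr (hw1 η i h)) (fun h => Or.inl (hw0 η i h))
  refine ⟨Finset.univ.image c, fun x => (Finset.univ.filter fun a => c a = x).card,
    v, w, ?_, ?_, ?_, ?_, ?_, ?_, ?_, ?_⟩
  · intro x hx
    obtain ⟨a, -, rfl⟩ := Finset.mem_image.1 hx
    have := h1 a
    have : 0 ≤ ∑ i ∈ (Ep a).filter (fun i => s i < ε), s i :=
      Finset.sum_nonneg fun i hi => (hs i (hEp a (Finset.mem_filter.1 hi).1)).1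
    linarith
  · have := hcard (fun _ => 1)
    simp only [mul_one] at this
    rw [this]
    simp
  · intro z
    rw [hcard (fun x => x.alpha z), ← hPJ, Finset.filter_biUnion]
    refine Finset.card_biUnion_le.trans ?_
    exact Finset.sum_le_sum fun a _ => (hal a z).le
  · exact fun i _ η => ⟨hv i η, hw i η⟩
  · intro i hi
    have hiJ := (Finset.mem_filter.1 hi).1
    rw [← hPJ] at hiJ
    obtain ⟨a, -, ha⟩ := Finset.mem_biUnion.1 hiJ
    rw [← hun a] at ha
    refine le_trans ?_ (Finset.single_le_sum (fun η _ => ?_)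
      (Finset.mem_range.2 (Nat.lt_succ_of_le (c a).gamma_le)))
    · rcases Finset.mem_union.1 ha with h | h
      · have := hv1 _ i ⟨a, h, rfl⟩
        have := hnn _ (hw i (c a).gamma)
        linarith
      · have := hw1 _ i ⟨a, h, rfl⟩
        have := hnn _ (hv i (c a).gamma)
        linarith
    · exact add_nonneg (hnn _ (hv i η)) (hnn _ (hw i η))
  · intro η _
    rw [aux_count c (fun x => x.gamma = η) (fun x => 1 - bConfigLoad ε U x)]
    refine (aux_ind Ep J hEp (fun i => s i < ε) (fun a => (c a).gamma = η) s
      (fun i hi => (hs i hi).1) (fun i => v i η) (hv1 η) (hv0 η)).trans ?_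
    exact Finset.sum_le_sum fun a _ => h1 a
  · intro η _
    have := aux_count c (fun x => x.gamma = η)
      (fun x => (x.gammaP : ℝ) * ((x.gamma : ℝ) + 1) * ε)
    simp only [← mul_assoc] at this
    rw [this]
    refine (aux_ind Lp J hLp (fun i => s i < ε) (fun a => (c a).gamma = η)
      (fun i => s i + U / k) (fun i hi => add_nonneg (hs i hi).1 hUk)
      (fun i => w i η) (hw1 η) (hw0 η)).trans ?_
    exact Finset.sum_le_sum fun a _ => h2 a
  · intro η _
    have e1 := aux_count c (fun x => x.gamma = η) (fun x => ∑ z ∈ Z.attach, (x.alpha z : ℝ))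
    have e2 := aux_count c (fun x => x.gamma = η) (fun x => (x.delta : ℝ) * k)
    simp only [← mul_assoc] at e2
    rw [e1, e2]
    have e3 := aux_ind Ep J hEp (fun i => s i < ε) (fun a => (c a).gamma = η)
      (fun _ => 1) (fun i hi => zero_le_one) (fun i => v i η) (hv1 η) (hv0 η)
    simp only [mul_one] at e3
    refine (add_le_add_right e3 _).trans ?_
    rw [← Finset.sum_add_distrib]
    exact Finset.sum_le_sum fun a _ => h3 a
end

section
/- Let ε ∈ (0,1] with 1/ε a positive integer, let k be a positive integer, and let U ∈ (0,1]. Let p be a nonempty reformulated-feasible bin whose large items (those of size at least ε) have sizes in a finite set Z, and let E and L be its sets of early and late items, respectively. Define α_z as the number of large items of size z in p for each z ∈ Z, δ = ⌈|E|/k⌉, γ' = 1 if L ≠ ∅ and γ' = 0 otherwise, and γ = ⌊(Σ_{i∈L} ŝ_i)/ε⌋ if L ≠ ∅ and γ = 0 otherwise. Then Σ_{z∈Z} z·α_z + γ'·γ·ε + (δ − 1 + γ')·U is at most the reformulated load of p, and hence at most 1; in particular the configuration (α, δ, γ, γ') is feasible. -/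
open Finset

theorem stmt19_aux {ι : Type*} [DecidableEq ι] (Z : Finset ℝ) (s : ι → ℝ) (b : Finset ι) :
    (∑ z ∈ Z.attach, (z : ℝ) * ((b.filter fun i => s i = (z : ℝ)).card : ℝ)) =
      ∑ i ∈ b.filter (fun i => s i ∈ Z), s i := by
  rw [Finset.sum_attach Z (fun z => z * ((b.filter fun i => s i = z).card : ℝ))]
  rw [← Finset.sum_fiberwise_of_maps_to (s := b.filter (fun i => s i ∈ Z)) (t := Z) (g := s)
    (fun i hi => (Finset.mem_filter.mp hi).2)]
  refine Finset.sum_congr rfl fun z hz => ?_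
  have h : (b.filter (fun i => s i ∈ Z)).filter (fun i => s i = z) =
      b.filter (fun i => s i = z) := by
    ext i
    simp only [Finset.mem_filter]
    constructor
    · rintro ⟨⟨h1, _⟩, h2⟩
      exact ⟨h1, h2⟩
    · rintro ⟨h1, h2⟩
      exact ⟨⟨h1, h2 ▸ hz⟩, h2⟩
  rw [h, Finset.sum_congr rfl (fun i hi => (Finset.mem_filter.mp hi).2), Finset.sum_const,
    nsmul_eq_mul, mul_comm]

theorem stmt19 {ι : Type*} [DecidableEq ι] (ε : ℝ) (E : ℕ) (hε : 0 < ε) (hε1 : ε ≤ 1)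
    (hE : (E : ℝ) = 1 / ε) (k : ℕ) (hk : 0 < k) (U : ℝ) (hU : 0 < U) (hU1 : U ≤ 1)
    -- `Z` is the set of sizes of the large items of the bin
    (Z : Finset ℝ) (hZ : ∀ z ∈ Z, ε ≤ z)
    (s : ι → ℝ) (pbin : Finset ι) (hpne : pbin.Nonempty)
    (hsz : ∀ i ∈ pbin, 0 ≤ s i ∧ s i ≤ 1)
    (hlarge : ∀ i ∈ pbin, ε ≤ s i → s i ∈ Z)
    (Ep Lp : Finset ι) (hsplit : EarlySplit k E s pbin Ep Lp)
    (hfeas : rLoadEL k E U s Ep Lp ≤ 1)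
    (δ γ γ' : ℕ)
    (hδ : δ = ⌈(Ep.card : ℝ) / k⌉₊)
    (hγ' : γ' = if Lp.Nonempty then 1 else 0)
    (hγ : γ = if Lp.Nonempty then ⌊(∑ i ∈ Lp, (s i + U / k)) / ε⌋₊ else 0) :
    (∑ z ∈ Z.attach, (z : ℝ) * ((pbin.filter fun i => s i = (z : ℝ)).card : ℝ)) +
        (γ' : ℝ) * (γ : ℝ) * ε + ((δ : ℝ) - 1 + (γ' : ℝ)) * U ≤
      rLoadEL k E U s Ep Lp ∧
    (∑ z ∈ Z.attach, (z : ℝ) * ((pbin.filter fun i => s i = (z : ℝ)).card : ℝ)) +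
        (γ' : ℝ) * (γ : ℝ) * ε + ((δ : ℝ) - 1 + (γ' : ℝ)) * U ≤ 1 := by
  suffices h : (∑ z ∈ Z.attach, (z : ℝ) * ((pbin.filter fun i => s i = (z : ℝ)).card : ℝ)) +
        (γ' : ℝ) * (γ : ℝ) * ε + ((δ : ℝ) - 1 + (γ' : ℝ)) * U ≤
      rLoadEL k E U s Ep Lp from ⟨h, h.trans hfeas⟩
  obtain ⟨hdis, hun, hcard, hord⟩ := hsplit
  have hkR : (0 : ℝ) < k := by exact_mod_cast hk
  have hEp : ∀ i ∈ Ep, i ∈ pbin := fun i hi => hun ▸ Finset.mem_union_left _ hi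
  have hLp : ∀ i ∈ Lp, i ∈ pbin := fun i hi => hun ▸ Finset.mem_union_right _ hi
  have hEpos : (0 : ℝ) < E := by rw [hE]; positivity
  rw [stmt19_aux]
  by_cases hL : Lp.Nonempty
  · simp only [hL, if_true] at hγ hγ'
    unfold rLoadEL at hfeas ⊢
    simp only [hL, if_true] at hfeas ⊢
    have hc : Ep.card = k * E := by
      have h1 : Ep.card + Lp.card = pbin.card := by
        rw [← hun, Finset.card_union_of_disjoint hdis]
      have h2 := hL.card_pos
      rcases min_choice pbin.card (k * E) with h | h <;> omega
    have hLs : 0 ≤ ∑ i ∈ Lp, (s i + U / k) :=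
      Finset.sum_nonneg fun i hi => add_nonneg (hsz i (hLp i hi)).1 (by positivity)
    have hsmall : ∀ j ∈ Lp, s j < ε := by
      intro j hj
      by_contra hcon
      push Not at hcon
      have h1 : (Ep.card : ℝ) * ε ≤ ∑ i ∈ Ep, s i := by
        rw [← nsmul_eq_mul]
        exact Finset.card_nsmul_le_sum _ _ _ fun i hi => hcon.trans (hord i hi j hj)
      have h2 : (Ep.card : ℝ) * ε = k := by
        rw [hc]; push_cast; rw [hE]; field_simp
      have h3 : (1 : ℝ) ≤ k := by exact_mod_cast hk
      have h4 : 0 < (E : ℝ) * U := by positivity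
      linarith
    have hsum : ∑ i ∈ pbin.filter (fun i => s i ∈ Z), s i ≤ ∑ i ∈ Ep, s i := by
      apply Finset.sum_le_sum_of_subset_of_nonneg
      · intro i hi
        obtain ⟨hi1, hi2⟩ := Finset.mem_filter.mp hi
        rw [← hun] at hi1
        rcases Finset.mem_union.mp hi1 with h | h
        · exact h
        · exact absurd (hZ _ hi2) (not_le.mpr (hsmall i h))
      · intro i hi _
        exact (hsz i (hEp i hi)).1
    have hδE : δ = E := by
      rw [hδ, hc]; push_cast
      rw [mul_div_cancel_left₀ _ hkR.ne', Nat.ceil_natCast]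
    have hγε : (γ : ℝ) * ε ≤ ∑ i ∈ Lp, (s i + U / k) := by
      rw [hγ, ← le_div_iff₀ hε]
      exact Nat.floor_le (by positivity)
    rw [hγ', hδE]
    push_cast
    linarith
  · simp only [hL, if_false] at hγ hγ'
    unfold rLoadEL binLoad
    simp only [hL, if_false]
    have hb : Ep = pbin := by
      rw [← hun, Finset.not_nonempty_iff_eq_empty.mp hL, Finset.union_empty]
    have hsum : ∑ i ∈ pbin.filter (fun i => s i ∈ Z), s i ≤ ∑ i ∈ Ep, s i := by
      rw [hb]
      exact Finset.sum_le_sum_of_subset_of_nonneg (Finset.filter_subset _ _)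
        fun i hi _ => (hsz i hi).1
    have hpos : 0 < Ep.card := hb ▸ hpne.card_pos
    have hd : δ ≤ (Ep.card - 1) / k + 1 := by
      rw [hδ, Nat.ceil_le, div_le_iff₀ hkR]
      have h1 := Nat.lt_div_mul_add (a := Ep.card - 1) hk
      have h2 : Ep.card ≤ ((Ep.card - 1) / k + 1) * k := by
        rw [add_mul]; omega
      exact_mod_cast h2
    have hd' : (δ : ℝ) - 1 ≤ (((Ep.card - 1) / k : ℕ) : ℝ) := by
      have : (δ : ℝ) ≤ (((Ep.card - 1) / k : ℕ) : ℝ) + 1 := by exact_mod_cast hd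
      linarith
    have := mul_le_mul_of_nonneg_right hd' hU.le
    rw [hγ', hγ]
    push_cast at this ⊢
    linarith
end
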